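/- Let H ∈ (1/2, 3/4) ∪ (3/4, 1) and β = 2H−2. Define L₂(T) = ∫₀^T e^{−t₁} (∫_{[0,t₁]³} e^{s₁−|t₂−s₂|} (t₁−t₂)^β |s₁−s₂|^β dt₂ ds₁ ds₂) dt₁. Then, as T → ∞, L₂(T) = (1/2)·Γ(1+β)²·[(2β+3)(1 − 1/cos(βπ))(T − (2β+3)/2) − (β+1)(β+3)] + T^{2β+2}/((β+1)(2β+1)) − (2/(2β+1))·T^{2β+1} + O(T^{2β}). -/

import Mathlib

open Real MeasureTheory intervalIntegral

noncomputable def L2 (β T : ℝ) : ℝ :=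
  ∫ t₁ in (0:ℝ)..T, Real.exp (-t₁) *
    ∫ t₂ in (0:ℝ)..t₁, ∫ s₁ in (0:ℝ)..t₁, ∫ s₂ in (0:ℝ)..t₁,
      Real.exp (s₁ - |t₂ - s₂|) * (t₁ - t₂) ^ β * |s₁ - s₂| ^ β

open scoped Classical in
theorem setLIntegral_swap_of_iff {s t : Set ℝ} {S T : ℝ → Set ℝ} (hs : MeasurableSet s)
    (ht : MeasurableSet t) (hS : MeasurableSet {p : ℝ × ℝ | p.2 ∈ S p.1})
    (hT : MeasurableSet {p : ℝ × ℝ | p.2 ∈ T p.1})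
    (h : ∀ x y, (x ∈ s ∧ y ∈ S x) ↔ (y ∈ t ∧ x ∈ T y)) {f : ℝ → ℝ → ENNReal}
    (hf : Measurable fun p : ℝ × ℝ => f p.1 p.2) :
    ∫⁻ x in s, ∫⁻ y in S x, f x y = ∫⁻ y in t, ∫⁻ x in T y, f x y := by
  have hSx (x : ℝ) : MeasurableSet (S x) := measurable_prodMk_left hS
  have hTx (x : ℝ) : MeasurableSet (T x) := measurable_prodMk_left hT
  have hU : MeasurableSet {p : ℝ × ℝ | p.1 ∈ s ∧ p.2 ∈ S p.1} := (measurable_fst hs).inter hS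
  have h1 : ∫⁻ x in s, ∫⁻ y in S x, f x y
      = ∫⁻ x, ∫⁻ y, {p : ℝ × ℝ | p.1 ∈ s ∧ p.2 ∈ S p.1}.indicator (fun p => f p.1 p.2) (x, y) := by
    rw [← lintegral_indicator hs]
    refine lintegral_congr fun x => ?_
    by_cases hx : x ∈ s
    · rw [Set.indicator_of_mem hx, ← lintegral_indicator (hSx x)]
      refine lintegral_congr fun y => ?_
      rw [Set.indicator_apply, Set.indicator_apply]
      simp [hx]
    · simp [hx]
  have h2 : ∫⁻ y in t, ∫⁻ x in T y, f x y
      = ∫⁻ y, ∫⁻ x, {p : ℝ × ℝ | p.1 ∈ s ∧ p.2 ∈ S p.1}.indicator (fun p => f p.1 p.2) (x, y) := by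
    rw [← lintegral_indicator ht]
    refine lintegral_congr fun y => ?_
    by_cases hy : y ∈ t
    · rw [Set.indicator_of_mem hy, ← lintegral_indicator (hTx y)]
      refine lintegral_congr fun x => ?_
      rw [Set.indicator_apply, Set.indicator_apply]
      simp [h, hy]
    · simp [h, hy]
  rw [h1, h2]
  exact lintegral_lintegral_swap (hf.indicator hU).aemeasurable

open scoped Classical in
theorem measurable_setLIntegral {α : Type*} [MeasurableSpace α] {S : α → Set ℝ}
    (hS : MeasurableSet {p : α × ℝ | p.2 ∈ S p.1}) {f : α → ℝ → ENNReal}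
    (hf : Measurable fun p : α × ℝ => f p.1 p.2) :
    Measurable fun x => ∫⁻ y in S x, f x y := by
  have hSx (x : α) : MeasurableSet (S x) := measurable_prodMk_left hS
  have h1 : (fun x => ∫⁻ y in S x, f x y)
      = fun x => ∫⁻ y, {p : α × ℝ | p.2 ∈ S p.1}.indicator (fun p => f p.1 p.2) (x, y) := by
    ext x
    rw [← lintegral_indicator (hSx x)]
    refine lintegral_congr fun y => ?_
    rw [Set.indicator_apply, Set.indicator_apply]
    rfl
  rw [h1]
  exact (hf.indicator hS).lintegral_prod_right'

theorem measurableSet_mem_Ioo {α : Type*} [MeasurableSpace α] {a b : α → ℝ}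
    (ha : Measurable a) (hb : Measurable b) :
    MeasurableSet {p : α × ℝ | p.2 ∈ Set.Ioo (a p.1) (b p.1)} :=
  (measurableSet_lt (ha.comp measurable_fst) measurable_snd).inter
    (measurableSet_lt measurable_snd (hb.comp measurable_fst))

theorem measurable_setLIntegral_Ioo {α : Type*} [MeasurableSpace α] {a b : α → ℝ}
    (ha : Measurable a) (hb : Measurable b) {f : α → ℝ → ENNReal}
    (hf : Measurable fun p : α × ℝ => f p.1 p.2) :
    Measurable fun x => ∫⁻ y in Set.Ioo (a x) (b x), f x y :=
  measurable_setLIntegral (measurableSet_mem_Ioo ha hb) hf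

theorem setLIntegral_Ioo_swap {a t : ℝ} {f : ℝ → ℝ → ENNReal}
    (hf : Measurable fun p : ℝ × ℝ => f p.1 p.2) :
    ∫⁻ x in Set.Ioo a t, ∫⁻ y in Set.Ioo a x, f x y
      = ∫⁻ y in Set.Ioo a t, ∫⁻ x in Set.Ioo y t, f x y :=
  setLIntegral_swap_of_iff measurableSet_Ioo measurableSet_Ioo
    (measurableSet_mem_Ioo measurable_const measurable_id)
    (measurableSet_mem_Ioo measurable_id measurable_const)
    (by simp only [Set.mem_Ioo]; grind) hf

theorem setLIntegral_Ioi_swap {a : ℝ} {f : ℝ → ℝ → ENNReal}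
    (hf : Measurable fun p : ℝ × ℝ => f p.1 p.2) :
    ∫⁻ x in Set.Ioi a, ∫⁻ y in Set.Ioo a x, f x y
      = ∫⁻ y in Set.Ioi a, ∫⁻ x in Set.Ioi y, f x y :=
  setLIntegral_swap_of_iff measurableSet_Ioi measurableSet_Ioi
    (measurableSet_mem_Ioo measurable_const measurable_id)
    (measurableSet_lt measurable_fst measurable_snd)
    (fun _ _ => ⟨fun h => ⟨h.2.1, h.2.2⟩, fun h => ⟨Set.mem_Ioi.2 (lt_trans h.1 h.2), h⟩⟩) hf

theorem setLIntegral_Ioo_add {a b c : ℝ} (hab : a ≤ b) (hbc : b ≤ c) (f : ℝ → ENNReal) :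
    ∫⁻ x in Set.Ioo a c, f x = (∫⁻ x in Set.Ioo a b, f x) + ∫⁻ x in Set.Ioo b c, f x := by
  rw [setLIntegral_congr Ioo_ae_eq_Ioc, setLIntegral_congr (s := Set.Ioo a b) Ioo_ae_eq_Ioc,
    setLIntegral_congr (s := Set.Ioo b c) Ioo_ae_eq_Ioc, ← Set.Ioc_union_Ioc_eq_Ioc hab hbc,
    lintegral_union measurableSet_Ioc (Set.Ioc_disjoint_Ioc_of_le le_rfl)]

theorem setLIntegral_Ioi_eq_Ioo_add {a b : ℝ} (hab : a ≤ b) (f : ℝ → ENNReal) :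
    ∫⁻ x in Set.Ioi a, f x = (∫⁻ x in Set.Ioo a b, f x) + ∫⁻ x in Set.Ioi b, f x := by
  rw [setLIntegral_congr (s := Set.Ioo a b) Ioo_ae_eq_Ioc, ← Set.Ioc_union_Ioi_eq_Ioi hab,
    lintegral_union measurableSet_Ioi (Set.Ioc_disjoint_Ioi le_rfl)]

theorem setLIntegral_Ioo_square {a t : ℝ} {f : ℝ → ℝ → ENNReal}
    (hf : Measurable fun p : ℝ × ℝ => f p.1 p.2) :
    ∫⁻ x in Set.Ioo a t, ∫⁻ y in Set.Ioo a t, f x y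
      = ∫⁻ s in Set.Ioo a t, ((∫⁻ y in Set.Ioo a s, f s y) + ∫⁻ x in Set.Ioo a s, f x s) := by
  have h : ∫⁻ x in Set.Ioo a t, ∫⁻ y in Set.Ioo a t, f x y = ∫⁻ x in Set.Ioo a t,
      ((∫⁻ y in Set.Ioo a x, f x y) + ∫⁻ y in Set.Ioo x t, f x y) :=
    setLIntegral_congr_fun measurableSet_Ioo fun x hx => setLIntegral_Ioo_add hx.1.le hx.2.le _
  have hm : Measurable fun x => ∫⁻ y in Set.Ioo a x, f x y :=
    measurable_setLIntegral_Ioo measurable_const measurable_id hf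
  rw [h, lintegral_add_left hm, lintegral_add_left hm,
    setLIntegral_Ioo_swap (f := fun s x => f x s) (hf.comp measurable_swap)]

theorem setLIntegral_Ioi_square {a : ℝ} {f : ℝ → ℝ → ENNReal}
    (hf : Measurable fun p : ℝ × ℝ => f p.1 p.2) :
    ∫⁻ x in Set.Ioi a, ∫⁻ y in Set.Ioi a, f x y
      = ∫⁻ s in Set.Ioi a, ((∫⁻ y in Set.Ioo a s, f s y) + ∫⁻ x in Set.Ioo a s, f x s) := by
  have h : ∫⁻ x in Set.Ioi a, ∫⁻ y in Set.Ioi a, f x y = ∫⁻ x in Set.Ioi a,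
      ((∫⁻ y in Set.Ioo a x, f x y) + ∫⁻ y in Set.Ioi x, f x y) :=
    setLIntegral_congr_fun measurableSet_Ioi fun x hx => setLIntegral_Ioi_eq_Ioo_add (le_of_lt hx) _
  have hm : Measurable fun x => ∫⁻ y in Set.Ioo a x, f x y :=
    measurable_setLIntegral_Ioo measurable_const measurable_id hf
  rw [h, lintegral_add_left hm, lintegral_add_left hm,
    setLIntegral_Ioi_swap (f := fun s x => f x s) (hf.comp measurable_swap)]

/-- Integration over a cube, sliced by the value of the largest coordinate. -/
theorem setLIntegral_Ioo_cube {a t : ℝ} {f : ℝ → ℝ → ℝ → ENNReal}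
    (hf : Measurable fun p : ℝ × ℝ × ℝ => f p.1 p.2.1 p.2.2) :
    ∫⁻ u in Set.Ioo a t, ∫⁻ v in Set.Ioo a t, ∫⁻ w in Set.Ioo a t, f u v w
      = ∫⁻ s in Set.Ioo a t,
        ((∫⁻ v in Set.Ioo a s, ∫⁻ w in Set.Ioo a s, f s v w)
          + ((∫⁻ u in Set.Ioo a s, ∫⁻ w in Set.Ioo a s, f u s w)
            + ∫⁻ u in Set.Ioo a s, ∫⁻ v in Set.Ioo a s, f u v s)) := by
  have hfu (u : ℝ) : Measurable fun p : ℝ × ℝ => f u p.1 p.2 := hf.comp measurable_prodMk_left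
  have hf1 : Measurable fun p : ℝ × ℝ => ∫⁻ w in Set.Ioo a p.2, f p.1 p.2 w :=
    measurable_setLIntegral_Ioo (f := fun (p : ℝ × ℝ) w => f p.1 p.2 w) measurable_const
      measurable_snd (hf.comp (by fun_prop :
        Measurable fun q : (ℝ × ℝ) × ℝ => (q.1.1, q.1.2, q.2)))
  have hf2 : Measurable fun p : ℝ × ℝ => ∫⁻ v in Set.Ioo a p.2, f p.1 v p.2 :=
    measurable_setLIntegral_Ioo (f := fun (p : ℝ × ℝ) v => f p.1 v p.2) measurable_const
      measurable_snd (hf.comp (by fun_prop :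
        Measurable fun q : (ℝ × ℝ) × ℝ => (q.1.1, q.2, q.1.2)))
  have hG := hf1.add hf2
  simp_rw [setLIntegral_Ioo_square (hfu _)]
  rw [setLIntegral_Ioo_square (f := fun u s => (∫⁻ w in Set.Ioo a s, f u s w)
    + ∫⁻ v in Set.Ioo a s, f u v s) hG]
  refine lintegral_congr fun s => ?_
  congr 1
  exact lintegral_add_left (hf1.comp (by fun_prop : Measurable fun u : ℝ => (u, s))) _

theorem setLIntegral_Ioo_sub_left (t : ℝ) (f : ℝ → ENNReal) :
    ∫⁻ x in Set.Ioo 0 t, f (t - x) = ∫⁻ x in Set.Ioo 0 t, f x := by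
  rw [← lintegral_indicator measurableSet_Ioo, ← lintegral_indicator measurableSet_Ioo,
    ← lintegral_sub_left_eq_self _ t]
  refine lintegral_congr fun x => ?_
  simp only [Set.indicator_apply, Set.mem_Ioo]
  grind

theorem setLIntegral_Ioo_sub_right (a b c : ℝ) (f : ℝ → ENNReal) :
    ∫⁻ x in Set.Ioo a b, f (x - c) = ∫⁻ x in Set.Ioo (a - c) (b - c), f x := by
  rw [← lintegral_indicator measurableSet_Ioo, ← lintegral_indicator measurableSet_Ioo,
    ← lintegral_sub_right_eq_self ((Set.Ioo (a - c) (b - c)).indicator f) c]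
  refine lintegral_congr fun x => ?_
  simp only [Set.indicator_apply, Set.mem_Ioo]
  grind

/-- Double integrals of functions of the difference of the two variables. -/
theorem setLIntegral_Ioo_difference (t : ℝ) {q : ℝ → ENNReal} (hq : Measurable q) :
    ∫⁻ v in Set.Ioo 0 t, ∫⁻ w in Set.Ioo 0 t, q (w - v)
      = ∫⁻ r in Set.Ioo 0 t, ENNReal.ofReal (t - r) * (q r + q (-r)) := by
  have hm : Measurable fun p : ℝ × ℝ => q (p.2 - p.1) := by fun_prop
  have hm1 : Measurable fun p : ℝ × ℝ => q (-p.2) := by fun_prop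
  have hm2 : Measurable fun p : ℝ × ℝ => q p.2 := by fun_prop
  rw [setLIntegral_Ioo_square (f := fun v w => q (w - v)) hm]
  have h : ∀ s ∈ Set.Ioo 0 t, (∫⁻ y in Set.Ioo 0 s, q (y - s)) + ∫⁻ x in Set.Ioo 0 s, q (s - x)
      = ∫⁻ r in Set.Ioo 0 s, (q r + q (-r)) := by
    intro s _
    rw [lintegral_add_left hq, setLIntegral_Ioo_sub_left s q,
      ← setLIntegral_Ioo_sub_left s (fun r => q (-r)), add_comm]
    simp only [neg_sub]
  rw [setLIntegral_congr_fun measurableSet_Ioo h,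
    setLIntegral_Ioo_swap (f := fun _ r => q r + q (-r)) (by fun_prop)]
  refine setLIntegral_congr_fun measurableSet_Ioo fun r hr => ?_
  simp [mul_comm]

theorem intervalIntegrable_rpow_mul_rpow_sub {β x T : ℝ} (hβ : -1 < β) (hx : 0 < x) (hT : x ≤ T) :
    IntervalIntegrable (fun t => t ^ β * (t - x) ^ β) volume x T := by
  have h : IntervalIntegrable (fun t : ℝ => (t - x) ^ β) volume x T := by
    have := (intervalIntegrable_rpow' (a := 0) (b := T - x) hβ).comp_sub_right x
    simpa using this
  refine h.continuousOn_mul (ContinuousOn.rpow_const continuousOn_id fun t ht => Or.inl ?_)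
  rw [Set.uIcc_of_le hT] at ht
  exact (hx.trans_le ht.1).ne'

theorem integral_rpow_mul_rpow_sub {β x T : ℝ} (hβ : -1 < β) (hx : 0 < x) (hT : x ≤ T) :
    (2 * β + 1) * ∫ t in x..T, t ^ β * (t - x) ^ β
      = T ^ (β + 1) * (T - x) ^ (β + 1) / (T - x / 2)
        - (x / 2) ^ 2 * ∫ t in x..T, t ^ β * (t - x) ^ β / (t - x / 2) ^ 2 := by
  have hi := intervalIntegrable_rpow_mul_rpow_sub hβ hx hT
  have hi2 : IntervalIntegrable (fun t => t ^ β * (t - x) ^ β / (t - x / 2) ^ 2) volume x T := by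
    simp_rw [div_eq_mul_inv]
    refine hi.mul_continuousOn (ContinuousOn.inv₀ (by fun_prop) fun t ht => ?_)
    rw [Set.uIcc_of_le hT] at ht
    have : 0 < t - x / 2 := by linarith [ht.1]
    positivity
  have key := integral_eq_sub_of_hasDerivAt_of_le hT
    (f := fun t => t ^ (β + 1) * (t - x) ^ (β + 1) / (t - x / 2))
    (f' := fun t => (2 * β + 1) * (t ^ β * (t - x) ^ β)
      + (x / 2) ^ 2 * (t ^ β * (t - x) ^ β / (t - x / 2) ^ 2)) ?_ ?_ ?_
  · rw [integral_add (hi.const_mul _) (hi2.const_mul _), intervalIntegral.integral_const_mul,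
      intervalIntegral.integral_const_mul] at key
    have h0 : (0 : ℝ) ^ (β + 1) = 0 := zero_rpow (by linarith)
    simp only [sub_self, h0, mul_zero, zero_div, sub_zero] at key
    linarith
  · refine ContinuousOn.div (ContinuousOn.mul ?_ ?_) (by fun_prop) fun t ht => ?_
    · exact ContinuousOn.rpow_const continuousOn_id fun t ht => Or.inr (by linarith)
    · exact ContinuousOn.rpow_const (by fun_prop) fun t ht => Or.inr (by linarith)
    · have : 0 < t - x / 2 := by linarith [ht.1]
      exact this.ne'
  · intro t ht
    have h1 : 0 < t := hx.trans ht.1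
    have h2 : 0 < t - x := sub_pos.2 ht.1
    have h3 : 0 < t - x / 2 := by linarith
    have d1 : HasDerivAt (fun t : ℝ => t ^ (β + 1)) ((β + 1) * t ^ β) t := by
      simpa using hasDerivAt_rpow_const (p := β + 1) (Or.inl h1.ne')
    have d2 : HasDerivAt (fun t : ℝ => (t - x) ^ (β + 1)) ((β + 1) * (t - x) ^ β) t := by
      simpa using ((hasDerivAt_id t).sub_const x).rpow_const (p := β + 1) (Or.inl h2.ne')
    have d3 : HasDerivAt (fun t : ℝ => t - x / 2) 1 t := (hasDerivAt_id t).sub_const _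
    refine ((d1.mul d2).div d3 h3.ne').congr_deriv ?_
    simp only [Pi.mul_apply]
    rw [rpow_add_one h1.ne', rpow_add_one h2.ne']
    rw [div_eq_iff (by positivity), add_mul _ ((x / 2) ^ 2 * _), mul_assoc ((x / 2) ^ 2),
      div_mul_cancel₀ _ (by positivity)]
    ring
  · exact (hi.const_mul _).add (hi2.const_mul _)

theorem integral_sub_mul_rpow_mul_rpow_sub {β x T : ℝ} (hβ : -1 < β) (hx : 0 < x) (hT : x ≤ T) :
    (2 * β + 1) * ∫ t in x..T, (T - t) * (t ^ β * (t - x) ^ β)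
      = T ^ (β + 1) * (T - x) ^ (β + 1) / (2 * (β + 1))
        - (T - x / 2) * (x / 2) ^ 2 * ∫ t in x..T, t ^ β * (t - x) ^ β / (t - x / 2) ^ 2 := by
  have hi := intervalIntegrable_rpow_mul_rpow_sub hβ hx hT
  have hi2 : IntervalIntegrable (fun t => (t - x / 2) * (t ^ β * (t - x) ^ β)) volume x T :=
    hi.continuousOn_mul (by fun_prop)
  have key := integral_eq_sub_of_hasDerivAt_of_le hT
    (f := fun t => t ^ (β + 1) * (t - x) ^ (β + 1))
    (f' := fun t => 2 * (β + 1) * ((t - x / 2) * (t ^ β * (t - x) ^ β))) ?_ ?_ ?_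
  · have h1 := integral_rpow_mul_rpow_sub hβ hx hT
    have h0 : (0 : ℝ) ^ (β + 1) = 0 := zero_rpow (by linarith)
    rw [intervalIntegral.integral_const_mul] at key
    simp only [sub_self, h0, mul_zero, sub_zero] at key
    have h2 : ∫ t in x..T, (T - t) * (t ^ β * (t - x) ^ β)
        = (T - x / 2) * (∫ t in x..T, t ^ β * (t - x) ^ β)
          - ∫ t in x..T, (t - x / 2) * (t ^ β * (t - x) ^ β) := by
      rw [← intervalIntegral.integral_const_mul, ← integral_sub (hi.const_mul _) hi2]
      exact integral_congr fun t _ => by ring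
    have h3 : T - x / 2 ≠ 0 := by linarith
    have h4 : β + 1 ≠ 0 := by linarith
    rw [h2, mul_sub, mul_left_comm, h1, ← key]
    generalize (∫ t in x..T, (t - x / 2) * (t ^ β * (t - x) ^ β)) = A at key ⊢
    rw [mul_sub, mul_div_cancel₀ _ h3]
    field_simp
    ring
  · refine ContinuousOn.mul ?_ ?_
    · exact ContinuousOn.rpow_const continuousOn_id fun t ht => Or.inr (by linarith)
    · exact ContinuousOn.rpow_const (by fun_prop) fun t ht => Or.inr (by linarith)
  · intro t ht
    have h1 : 0 < t := hx.trans ht.1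
    have h2 : 0 < t - x := sub_pos.2 ht.1
    have d1 : HasDerivAt (fun t : ℝ => t ^ (β + 1)) ((β + 1) * t ^ β) t := by
      simpa using hasDerivAt_rpow_const (p := β + 1) (Or.inl h1.ne')
    have d2 : HasDerivAt (fun t : ℝ => (t - x) ^ (β + 1)) ((β + 1) * (t - x) ^ β) t := by
      simpa using ((hasDerivAt_id t).sub_const x).rpow_const (p := β + 1) (Or.inl h2.ne')
    refine (d1.mul d2).congr_deriv ?_
    rw [rpow_add_one h1.ne', rpow_add_one h2.ne']
    ring
  · exact hi2.const_mul _

theorem lintegral_rpow_mul_rpow_sub_div_sq {β x : ℝ} (hβ : -1 < β) (hβ' : β < 1 / 2) (hx : 0 < x) :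
    ∫⁻ t in Set.Ioi x, ENNReal.ofReal (t ^ β * (t - x) ^ β / (t - x / 2) ^ 2)
      = ENNReal.ofReal ((x / 2) ^ (2 * β - 1)
        * (ProbabilityTheory.beta (1 / 2 - β) (β + 1) / 2)) := by
  set y := x / 2 with hy
  have hxy : x = 2 * y := by rw [hy]; ring
  have hy0 : 0 < y := by positivity
  have hB : 0 < ProbabilityTheory.beta (1 / 2 - β) (β + 1) :=
    ProbabilityTheory.beta_pos (by linarith) (by linarith)
  have himage : (fun z : ℝ => y * (1 + z ^ (-(1 / 2) : ℝ))) '' Set.Ioo 0 1 = Set.Ioi x := by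
    ext t
    constructor
    · rintro ⟨z, hz, rfl⟩
      have := one_lt_rpow_of_pos_of_lt_one_of_neg hz.1 hz.2 (by norm_num : (-(1 / 2) : ℝ) < 0)
      simp only [Set.mem_Ioi]
      nlinarith
    · intro ht
      have ht' : 1 < t / y - 1 := by
        rw [lt_sub_iff_add_lt, lt_div_iff₀ hy0]
        have : x < t := ht
        linarith
      refine ⟨(t / y - 1) ^ (-2 : ℝ), ⟨by positivity, ?_⟩, ?_⟩
      · exact rpow_lt_one_of_one_lt_of_neg ht' (by norm_num)
      · simp only
        rw [← rpow_mul (by linarith)]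
        norm_num
        field_simp
  have hinj : Set.InjOn (fun z : ℝ => y * (1 + z ^ (-(1 / 2) : ℝ))) (Set.Ioo 0 1) := by
    intro a ha b hb hab
    simp only [mul_eq_mul_left_iff, add_right_inj, hy0.ne', or_false] at hab
    exact (rpow_left_inj ha.1.le hb.1.le (by norm_num)).1 hab
  rw [← himage, lintegral_image_eq_lintegral_abs_deriv_mul measurableSet_Ioo
    (f' := fun z => y * (-(1 / 2) * z ^ (-(1 / 2) - 1 : ℝ))) (fun z hz => ?_) hinj]
  · have h1 := ProbabilityTheory.lintegral_betaPDF_eq_one (α := 1 / 2 - β) (β := β + 1)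
      (by linarith) (by linarith)
    rw [ProbabilityTheory.lintegral_betaPDF] at h1
    rw [← mul_one (ENNReal.ofReal _), ← h1, ← lintegral_const_mul _ (by fun_prop)]
    refine setLIntegral_congr_fun measurableSet_Ioo fun z hz => ?_
    rw [← ENNReal.ofReal_mul (abs_nonneg _), ← ENNReal.ofReal_mul (by positivity)]
    congr 1
    have hz0 := hz.1
    have hz1 : 0 < 1 - z := sub_pos.2 hz.2
    obtain ⟨s, hs, rfl⟩ : ∃ s : ℝ, 0 < s ∧ z = s ^ 2 :=
      ⟨√z, Real.sqrt_pos.2 hz0, (Real.sq_sqrt hz0.le).symm⟩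
    have e1 : ((s ^ 2 : ℝ)) ^ (-(1 / 2) : ℝ) = s⁻¹ := by
      rw [← rpow_natCast, ← rpow_mul hs.le, ← rpow_neg_one]; norm_num
    have e2 : ((s ^ 2 : ℝ)) ^ (-(1 / 2) - 1 : ℝ) = s⁻¹ ^ 3 := by
      rw [rpow_sub_one (by positivity), e1]; field_simp
    have e3 : ((s ^ 2 : ℝ)) ^ (1 / 2 - β - 1) = s⁻¹ * (s ^ 2) ^ (-β) := by
      rw [← e1, ← rpow_add (by positivity)]; ring_nf
    have e4 : (y * (1 + s⁻¹)) ^ β * (y * (1 + s⁻¹) - x) ^ β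
        = y ^ (2 * β) * (1 - s ^ 2) ^ β * (s ^ 2) ^ (-β) := by
      have hs1 : s < 1 := by nlinarith
      have hs2 : 0 < s⁻¹ - 1 := by
        have := (one_lt_inv₀ hs).2 hs1
        linarith
      rw [← mul_rpow (by positivity) (by rw [hxy]; nlinarith), rpow_neg (by positivity),
        ← inv_rpow (by positivity), two_mul, rpow_add hy0, ← mul_rpow hy0.le hy0.le,
        ← mul_rpow (by positivity) (by positivity), ← mul_rpow (by positivity) (by positivity)]
      congr 1
      rw [hxy]
      field_simp
      ring
    have e5 : (y * (1 + s⁻¹) - y) ^ 2 = y ^ 2 * s⁻¹ ^ 2 := by ring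
    have e6 : y ^ (2 * β - 1) = y ^ (2 * β) / y := rpow_sub_one hy0.ne' _
    rw [e1, e2, e3, e4, e5, e6, add_sub_cancel_right, abs_of_nonpos]
    · generalize ProbabilityTheory.beta (1 / 2 - β) (β + 1) = B at hB ⊢
      field_simp
    · have : 0 < y * s⁻¹ ^ 3 := by positivity
      linarith
  · refine HasDerivAt.hasDerivWithinAt (HasDerivAt.const_mul y (HasDerivAt.const_add 1 ?_))
    exact hasDerivAt_rpow_const (Or.inl hz.1.ne')

theorem div_two_rpow_le {p x : ℝ} (hp : -1 ≤ p) (hx : 0 < x) : (x / 2) ^ p ≤ 2 * x ^ p := by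
  rw [div_rpow hx.le (by norm_num), div_le_iff₀ (by positivity)]
  have h : (2:ℝ)⁻¹ ≤ 2 ^ p := by
    rw [← rpow_neg_one]
    exact rpow_le_rpow_of_exponent_le (by norm_num) hp
  have : 0 ≤ x ^ p * (2 ^ p - 2⁻¹) := mul_nonneg (by positivity) (by linarith)
  linarith

theorem integral_rpow_mul_rpow_sub_div_sq_tail {β x T : ℝ} (hβ : -1 < β) (hβ' : β < 0)
    (hx : 0 < x) (hxT : x ≤ T) (hT : 1 ≤ T) :
    ∃ e : ℝ, (x / 2) ^ 2 * ∫ t in x..T, t ^ β * (t - x) ^ β / (t - x / 2) ^ 2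
        = (x / 2) ^ (2 * β + 1) * (ProbabilityTheory.beta (1 / 2 - β) (β + 1) / 2) - e ∧ 0 ≤ e ∧
      (T - x / 2) * e ≤ T ^ (2 * β) *
        (2 * x ^ 2 + 16 * (ProbabilityTheory.beta (1 / 2 - β) (β + 1) / 2) * x ^ (2 * β + 4)) := by
  set B := ProbabilityTheory.beta (1 / 2 - β) (β + 1) / 2 with hB
  have hB0 : 0 < B := half_pos (ProbabilityTheory.beta_pos (by linarith) (by linarith))
  have hT0 : 0 < T := by linarith
  set h : ℝ → ℝ := fun t => t ^ β * (t - x) ^ β / (t - x / 2) ^ 2 with hh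
  have hpos : ∀ t ∈ Set.Ioi x, 0 ≤ h t := fun t ht => by
    have ht' : x < t := ht
    have : 0 ≤ t - x := by linarith
    have : 0 ≤ t := by linarith
    simp only [hh]
    positivity
  have hmeas : Measurable h := by
    simp only [hh]
    fun_prop
  have hlin := lintegral_rpow_mul_rpow_sub_div_sq hβ (by linarith : β < 1 / 2) hx
  have hae : 0 ≤ᵐ[volume.restrict (Set.Ioi x)] h :=
    (ae_restrict_iff' measurableSet_Ioi).2 (Filter.Eventually.of_forall hpos)
  have hint : IntegrableOn h (Set.Ioi x) :=
    ⟨hmeas.aestronglyMeasurable,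
      (hasFiniteIntegral_iff_ofReal hae).2 (hlin ▸ ENNReal.ofReal_lt_top)⟩
  have htot : ∫ t in Set.Ioi x, h t = (x / 2) ^ (2 * β - 1) * B := by
    rw [integral_eq_lintegral_of_nonneg_ae hae hmeas.aestronglyMeasurable, hlin,
      ENNReal.toReal_ofReal (by positivity)]
  have hint' : IntegrableOn h (Set.Ioi T) := hint.mono_set (Set.Ioi_subset_Ioi hxT)
  have hsplit := integral_interval_add_Ioi hint hint'
  have htail : 0 ≤ ∫ t in Set.Ioi T, h t :=
    setIntegral_nonneg measurableSet_Ioi fun t ht => hpos t (hxT.trans_lt ht)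
  have hhead : 0 ≤ ∫ t in x..T, h t := by
    rw [integral_of_le hxT]
    exact setIntegral_nonneg measurableSet_Ioc fun t ht => hpos t ht.1
  have hpow : (x / 2) ^ 2 * (x / 2) ^ (2 * β - 1) = (x / 2) ^ (2 * β + 1) := by
    rw [← rpow_natCast, ← rpow_add (by positivity)]
    congr 1
    push_cast
    ring
  refine ⟨(x / 2) ^ 2 * ∫ t in Set.Ioi T, h t, ?_, by positivity, ?_⟩
  · rw [← hpow, mul_assoc, ← htot, ← hsplit]
    ring
  have hT2 : 0 < T ^ (2 * β) := by positivity
  rcases le_or_gt x (T / 2) with hc | hc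
  · have hb : ∫ t in Set.Ioi T, h t ≤ 8 * T ^ (2 * β - 1) := by
      have h1 : ∫ t in Set.Ioi T, h t ≤ ∫ t in Set.Ioi T, 8 * t ^ (2 * β - 2) := by
        refine setIntegral_mono_on hint'
          ((integrableOn_Ioi_rpow_of_lt (by linarith) hT0).const_mul 8) measurableSet_Ioi
          fun t ht => ?_
        have ht : T < t := ht
        have ht0 : 0 < t := by linarith
        have e1 : (t - x) ^ β ≤ (t / 2) ^ β :=
          rpow_le_rpow_of_nonpos (by positivity) (by linarith) hβ'.le
        have e2 : (t / 2) ^ β ≤ 2 * t ^ β := div_two_rpow_le hβ.le ht0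
        have e3 : (t / 2) ^ 2 ≤ (t - x / 2) ^ 2 := by
          apply pow_le_pow_left₀ (by positivity); linarith
        have e4 : t ^ (2 * β - 2) = t ^ β * t ^ β / t ^ 2 := by
          rw [rpow_sub ht0, two_mul, rpow_add ht0]; norm_num
        calc h t ≤ t ^ β * (2 * t ^ β) / (t / 2) ^ 2 := by
              simp only [hh]
              gcongr
              exact e1.trans e2
          _ = 8 * t ^ (2 * β - 2) := by rw [e4]; field_simp; norm_num
      rw [MeasureTheory.integral_const_mul, integral_Ioi_rpow_of_lt (by linarith) hT0] at h1
      refine h1.trans ?_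
      rw [show 2 * β - 2 + 1 = -(1 - 2 * β) by ring, neg_div_neg_eq,
        show -(1 - 2 * β) = 2 * β - 1 by ring]
      gcongr
      exact div_le_self (by positivity) (by linarith)
    have hT1 : T * T ^ (2 * β - 1) = T ^ (2 * β) := by
      rw [rpow_sub_one hT0.ne']; field_simp
    calc (T - x / 2) * ((x / 2) ^ 2 * ∫ t in Set.Ioi T, h t)
        ≤ T * ((x / 2) ^ 2 * (8 * T ^ (2 * β - 1))) := by gcongr; linarith
      _ = T ^ (2 * β) * (2 * x ^ 2) := by rw [← hT1]; ring
      _ ≤ _ := by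
        gcongr
        have : 0 ≤ 16 * B * x ^ (2 * β + 4) := by positivity
        linarith
  · have hb : (x / 2) ^ 2 * ∫ t in Set.Ioi T, h t ≤ (x / 2) ^ (2 * β + 1) * B := by
      rw [← hpow, mul_assoc, ← htot, ← hsplit]
      gcongr
      linarith
    have e1 : T ≤ 8 * x ^ 3 * T ^ (2 * β) := by
      have h1 : T ^ (1 - 2 * β) ≤ T ^ (3:ℝ) :=
        rpow_le_rpow_of_exponent_le hT (by linarith)
      have h2 : T ^ (3:ℝ) ≤ 8 * x ^ 3 := by
        rw [show (3:ℝ) = (3:ℕ) by norm_num, rpow_natCast,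
          show 8 * x ^ 3 = (2 * x) ^ 3 by ring]
        apply pow_le_pow_left₀ hT0.le; linarith
      calc T = T ^ (1 - 2 * β) * T ^ (2 * β) := by rw [← rpow_add hT0]; simp
        _ ≤ _ := by gcongr; exact h1.trans h2
    have e2 : (x / 2) ^ (2 * β + 1) ≤ 2 * x ^ (2 * β + 1) := div_two_rpow_le (by linarith) hx
    have e3 : x ^ (2 * β + 4) = x ^ (2 * β + 1) * x ^ 3 := by
      rw [← rpow_natCast, ← rpow_add hx]; congr 1; push_cast; ring
    calc (T - x / 2) * ((x / 2) ^ 2 * ∫ t in Set.Ioi T, h t)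
        ≤ T * (2 * x ^ (2 * β + 1) * B) := by
          refine mul_le_mul (by linarith) (hb.trans (by gcongr)) (by positivity) hT0.le
      _ ≤ 8 * x ^ 3 * T ^ (2 * β) * (2 * x ^ (2 * β + 1) * B) := by gcongr
      _ = T ^ (2 * β) * (16 * B * x ^ (2 * β + 4)) := by rw [e3]; ring
      _ ≤ _ := by
        gcongr
        have : 0 ≤ 2 * x ^ 2 := by positivity
        linarith

theorem abs_one_sub_rpow_sub_le {a ξ : ℝ} (ha : 0 < a) (ha' : a < 1) (hξ' : ξ ≤ 1) :
    |(1 - ξ) ^ a - 1 + a * ξ| ≤ ξ ^ 2 := by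
  have h1 : (1 - ξ) ^ a ≤ 1 - a * ξ := by
    have := rpow_one_add_le_one_add_mul_self (s := -ξ) (by linarith) ha.le ha'.le
    rw [← sub_eq_add_neg] at this
    linarith
  have h2 : (1 - ξ) ^ (1 - a) ≤ 1 - (1 - a) * ξ := by
    have := rpow_one_add_le_one_add_mul_self (s := -ξ) (p := 1 - a) (by linarith) (by linarith)
      (by linarith)
    rw [← sub_eq_add_neg] at this
    linarith
  have h3 : (1 - ξ) ^ a * (1 - ξ) ^ (1 - a) = 1 - ξ := by
    rw [← rpow_add_of_nonneg (by linarith) ha.le (by linarith)]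
    simp
  have h0 : 0 ≤ (1 - ξ) ^ a := rpow_nonneg (by linarith) _
  have hq : 0 < 1 - (1 - a) * ξ := by nlinarith
  have h4 : 1 - ξ ≤ (1 - ξ) ^ a * (1 - (1 - a) * ξ) :=
    h3.symm.le.trans (by gcongr)
  have h5 : (1 - a * ξ - ξ ^ 2) * (1 - (1 - a) * ξ) ≤ 1 - ξ := by
    have : 0 ≤ 1 - a * (1 - a) - (1 - a) * ξ := by nlinarith
    nlinarith [mul_nonneg (sq_nonneg ξ) this]
  have h6 : 1 - a * ξ - ξ ^ 2 ≤ (1 - ξ) ^ a := le_of_mul_le_mul_right (h5.trans h4) hq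
  rw [abs_le]
  constructor <;> nlinarith [sq_nonneg ξ]

theorem abs_one_sub_rpow_div_sub_one_le {a ξ : ℝ} (ha : 0 < a) (ha' : a < 1) (hξ : 0 ≤ ξ)
    (hξ' : ξ ≤ 1) : |(1 - ξ) ^ a / (1 - ξ / 2) - 1| ≤ ξ := by
  have h0 : 0 < 1 - ξ / 2 := by linarith
  have h1 : (1 - ξ) ^ a ≤ 1 := rpow_le_one (by linarith) (by linarith) ha.le
  have h2 : 1 - ξ ≤ (1 - ξ) ^ a := by
    rcases hξ'.eq_or_lt with h | h
    · rw [h]; simp [ha.ne']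
    · simpa using rpow_le_rpow_of_exponent_ge (sub_pos.2 h) (by linarith) ha'.le
  rw [abs_le]
  constructor
  · rw [le_sub_iff_add_le, le_div_iff₀ h0]
    nlinarith
  · rw [sub_le_iff_le_add, div_le_iff₀ h0]
    nlinarith

/-- The leading part, as `T → ∞`, of the integrand in `x` obtained after integrating out `t`. -/
noncomputable def mainTerm (β B T x : ℝ) : ℝ :=
  (1 + x) * (T ^ (2 * β + 2) - (β + 1) * x * T ^ (2 * β + 1)) / (2 * (β + 1))
    - T ^ (2 * β + 1) / 2 - (x / 2) ^ (2 * β + 1) * B * ((1 + x) * (T - x / 2) - 1 / 2)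

/-- The weight bounding the deviation from `mainTerm`, up to the factor `T ^ (2 * β)`. -/
noncomputable def errorWeight (β B x : ℝ) : ℝ :=
  (1 + x) * (x ^ 2 / (β + 1) + x + 2 * x ^ 2 + 16 * B * x ^ (2 * β + 4))

theorem abs_sub_mainTerm_le {β B T x e : ℝ} (hβ : -1 < β) (hβ' : β < 0)
    (hx : 0 < x) (hxT : x ≤ T) (hT : 1 ≤ T) (he : 0 ≤ e)
    (he' : (T - x / 2) * e ≤ T ^ (2 * β) * (2 * x ^ 2 + 16 * B * x ^ (2 * β + 4))) :
    |T ^ (β + 1) * (T - x) ^ (β + 1) * ((1 + x) / (2 * (β + 1)) - 1 / (2 * (T - x / 2)))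
        - ((1 + x) * (T - x / 2) - 1 / 2) * ((x / 2) ^ (2 * β + 1) * B - e)
        - mainTerm β B T x| ≤ T ^ (2 * β) * errorWeight β B x := by
  have hT0 : 0 < T := by linarith
  have ha : 0 < β + 1 := by linarith
  obtain ⟨ξ, rfl⟩ : ∃ ξ, x = T * ξ := ⟨x / T, by field_simp⟩
  have hξ : 0 < ξ := pos_of_mul_pos_right hx hT0.le
  have hξ1 : ξ ≤ 1 := by
    by_contra! h
    nlinarith
  have b1 := abs_one_sub_rpow_sub_le ha (by linarith) hξ1
  have b2 := abs_one_sub_rpow_div_sub_one_le ha (by linarith) hξ.le hξ1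
  have hN : T ^ (β + 1) * (T - T * ξ) ^ (β + 1) = T ^ (2 * β) * T ^ 2 * (1 - ξ) ^ (β + 1) := by
    rw [show T - T * ξ = T * (1 - ξ) by ring, mul_rpow hT0.le (by linarith), ← mul_assoc,
      ← rpow_add hT0, ← rpow_natCast, ← rpow_add hT0]
    congr 2
    push_cast
    ring
  have hp2 : T ^ (2 * β + 2) = T ^ (2 * β) * T ^ 2 := by
    rw [← rpow_natCast, ← rpow_add hT0]; norm_num
  have hp1 : T ^ (2 * β + 1) = T ^ (2 * β) * T := by
    rw [rpow_add_one hT0.ne']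
  set P := T ^ (2 * β) with hP
  have hP0 : 0 < P := by positivity
  set p := (1 - ξ) ^ (β + 1) with hp
  set W := (T * ξ) ^ (2 * β + 4) with hW
  set V := (T * ξ / 2) ^ (2 * β + 1) with hV
  have hd : 0 < 1 - ξ / 2 := by linarith
  have key : T ^ (β + 1) * (T - T * ξ) ^ (β + 1)
          * ((1 + T * ξ) / (2 * (β + 1)) - 1 / (2 * (T - T * ξ / 2)))
        - ((1 + T * ξ) * (T - T * ξ / 2) - 1 / 2) * (V * B - e)
        - mainTerm β B T (T * ξ)
      = P * T ^ 2 * (1 + T * ξ) / (2 * (β + 1)) * (p - 1 + (β + 1) * ξ)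
        - P * T / 2 * (p / (1 - ξ / 2) - 1) + ((1 + T * ξ) * (T - T * ξ / 2) - 1 / 2) * e := by
    rw [hN, mainTerm, hp2, hp1, show T - T * ξ / 2 = T * (1 - ξ / 2) by ring]
    field_simp
    ring
  rw [key]
  have c1 : |P * T ^ 2 * (1 + T * ξ) / (2 * (β + 1)) * (p - 1 + (β + 1) * ξ)|
      ≤ P * T ^ 2 * (1 + T * ξ) / (2 * (β + 1)) * ξ ^ 2 := by
    rw [abs_mul, abs_of_nonneg (by positivity)]
    gcongr
  have c2 : |P * T / 2 * (p / (1 - ξ / 2) - 1)| ≤ P * T / 2 * ξ := by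
    rw [abs_mul, abs_of_nonneg (by positivity)]
    gcongr
  have c3 : |((1 + T * ξ) * (T - T * ξ / 2) - 1 / 2) * e|
      ≤ (1 + T * ξ) * (P * (2 * (T * ξ) ^ 2 + 16 * B * W)) := by
    have h1 : (1:ℝ) / 2 ≤ T - T * ξ / 2 := by linarith
    have h2 : T - T * ξ / 2 ≤ (1 + T * ξ) * (T - T * ξ / 2) := by nlinarith
    rw [abs_of_nonneg (mul_nonneg (by linarith) he)]
    calc _ ≤ (1 + T * ξ) * (T - T * ξ / 2) * e := by gcongr; linarith
      _ ≤ _ := by rw [mul_assoc]; gcongr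
  refine (abs_add_le _ _).trans ((add_le_add_left ((abs_sub _ _).trans (add_le_add c1 c2)) _).trans
    ((add_le_add_right c3 _).trans ?_))
  have d1 : P * T ^ 2 * (1 + T * ξ) / (2 * (β + 1)) * ξ ^ 2
      ≤ P * ((1 + T * ξ) * ((T * ξ) ^ 2 / (β + 1))) := by
    have : P * T ^ 2 * (1 + T * ξ) / (2 * (β + 1)) * ξ ^ 2
      = P * ((1 + T * ξ) * ((T * ξ) ^ 2 / (β + 1))) / 2 := by field_simp
    rw [this]
    exact half_le_self (by positivity)
  have d2 : P * T / 2 * ξ ≤ P * ((1 + T * ξ) * (T * ξ)) := by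
    have : P * T / 2 * ξ = P * (T * ξ) / 2 := by ring
    nlinarith [mul_pos hP0 hx, mul_pos hP0 (mul_pos hx hx)]
  rw [errorWeight]
  calc _ ≤ P * ((1 + T * ξ) * ((T * ξ) ^ 2 / (β + 1))) + P * ((1 + T * ξ) * (T * ξ))
        + (1 + T * ξ) * (P * (2 * (T * ξ) ^ 2 + 16 * B * W)) := by gcongr
    _ = _ := by ring

theorem abs_mainTerm_le {β B T x : ℝ} (hβ : -1 < β) (hβ' : β < 0) (hB : 0 ≤ B)
    (hxT : T ≤ x) (hT : 1 ≤ T) :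
    |mainTerm β B T x| ≤ T ^ (2 * β) * errorWeight β B x := by
  have hT0 : 0 < T := by linarith
  have hx : 0 < x := by linarith
  have ha : 0 < β + 1 := by linarith
  have hp2 : T ^ (2 * β + 2) = T ^ (2 * β) * T ^ 2 := by
    rw [← rpow_natCast, ← rpow_add hT0]; norm_num
  have hp1 : T ^ (2 * β + 1) = T ^ (2 * β) * T := by
    rw [rpow_add_one hT0.ne']
  have h1 : 1 ≤ T ^ (2 * β) * x ^ 2 := by
    have : 1 ≤ T ^ (2 * β) * T ^ 2 := by
      rw [← hp2]; exact one_le_rpow hT (by linarith)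
    exact this.trans (by gcongr)
  have e2 : (x / 2) ^ (2 * β + 1) ≤ 2 * x ^ (2 * β + 1) := div_two_rpow_le (by linarith) hx
  have e3 : x ^ (2 * β + 4) = x ^ (2 * β + 1) * x ^ 3 := by
    rw [← rpow_natCast, ← rpow_add hx]; congr 1; push_cast; ring
  rw [mainTerm, errorWeight, hp2, hp1, e3]
  set P := T ^ (2 * β) with hP
  have hP0 : 0 < P := by positivity
  set V := x ^ (2 * β + 1) with hV
  have hV0 : 0 < V := by positivity
  have c1 : |(1 + x) * (P * T ^ 2 - (β + 1) * x * (P * T)) / (2 * (β + 1))|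
      ≤ P * ((1 + x) * (x ^ 2 / (β + 1))) := by
    have : (1 + x) * (P * T ^ 2 - (β + 1) * x * (P * T)) / (2 * (β + 1))
      = P * ((1 + x) * (T ^ 2 - (β + 1) * x * T) / (2 * (β + 1))) := by ring
    rw [this, abs_mul, abs_of_pos hP0, abs_div, abs_mul, abs_of_pos (by linarith : 0 < 1 + x),
      abs_of_pos (by linarith : 0 < 2 * (β + 1))]
    have h2 : |T ^ 2 - (β + 1) * x * T| ≤ 2 * x ^ 2 := by
      have : T ^ 2 ≤ x ^ 2 := by gcongr
      have h3 : x * T ≤ x ^ 2 := by nlinarith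
      have h4 : 0 ≤ (β + 1) * (x * T) := by positivity
      have h5 : (β + 1) * (x * T) ≤ 1 * x ^ 2 := by gcongr; linarith
      rw [abs_le]; constructor <;> nlinarith [sq_nonneg x]
    have : P * ((1 + x) * (x ^ 2 / (β + 1))) = P * ((1 + x) * (2 * x ^ 2) / (2 * (β + 1))) := by
      field_simp
    rw [this]
    gcongr
  have c2 : |P * T / 2| ≤ P * ((1 + x) * x) := by
    rw [abs_of_pos (by positivity)]
    have : T / 2 ≤ (1 + x) * x := by nlinarith
    calc P * T / 2 = P * (T / 2) := by ring
      _ ≤ _ := by gcongr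
  have c3 : |(x / 2) ^ (2 * β + 1) * B * ((1 + x) * (T - x / 2) - 1 / 2)|
      ≤ P * ((1 + x) * (16 * B * (V * x ^ 3))) := by
    have h2 : |(1 + x) * (T - x / 2) - 1 / 2| ≤ (1 + x) * (2 * x) := by
      rw [abs_le]; constructor <;> nlinarith
    rw [abs_mul, abs_of_nonneg (by positivity)]
    calc _ ≤ 2 * V * B * ((1 + x) * (2 * x)) := by gcongr
      _ = 1 * (2 * V * B * ((1 + x) * (2 * x))) := by ring
      _ ≤ P * x ^ 2 * (2 * V * B * ((1 + x) * (2 * x))) := by gcongr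
      _ = P * ((1 + x) * (4 * B * (V * x ^ 3))) := by ring
      _ ≤ _ := by gcongr; norm_num
  refine (abs_sub _ _).trans ((add_le_add ((abs_sub _ _).trans (add_le_add c1 c2)) c3).trans ?_)
  have : 0 ≤ P * ((1 + x) * (2 * x ^ 2)) := by positivity
  linarith

theorem integrableOn_exp_neg_mul_rpow {p : ℝ} (hp : -1 < p) :
    IntegrableOn (fun x : ℝ => exp (-x) * x ^ p) (Set.Ioi 0) := by
  simpa using GammaIntegral_convergent (s := p + 1) (by linarith)

theorem setIntegral_exp_neg_mul_rpow {p : ℝ} (hp : -1 < p) :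
    ∫ x in Set.Ioi (0:ℝ), exp (-x) * x ^ p = Gamma (p + 1) := by
  rw [Gamma_eq_integral (by linarith)]
  simp

theorem integrableOn_exp_neg_mul_pow (n : ℕ) :
    IntegrableOn (fun x : ℝ => exp (-x) * x ^ n) (Set.Ioi 0) := by
  simpa using integrableOn_exp_neg_mul_rpow (p := n) (by linarith [n.cast_nonneg (α := ℝ)])

theorem setIntegral_exp_neg_mul_pow (n : ℕ) :
    ∫ x in Set.Ioi (0:ℝ), exp (-x) * x ^ n = n.factorial := by
  have := setIntegral_exp_neg_mul_rpow (p := n) (by linarith [n.cast_nonneg (α := ℝ)])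
  rw [Gamma_nat_eq_factorial] at this
  simpa using this

theorem integrableOn_exp_neg_mul_errorWeight {β : ℝ} (B : ℝ) (hβ : -1 < β) :
    IntegrableOn (fun x => exp (-x) * errorWeight β B x) (Set.Ioi 0) := by
  have h := (((((integrableOn_exp_neg_mul_pow 2).const_mul (1 / (β + 1) + 3)).add
    ((integrableOn_exp_neg_mul_pow 3).const_mul (1 / (β + 1) + 2))).add
    (integrableOn_exp_neg_mul_pow 1)).add
    ((integrableOn_exp_neg_mul_rpow (p := 2 * β + 4) (by linarith)).const_mul (16 * B))).add
    ((integrableOn_exp_neg_mul_rpow (p := 2 * β + 5) (by linarith)).const_mul (16 * B))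
  refine IntegrableOn.congr_fun h (fun x hx => ?_) measurableSet_Ioi
  have hx : 0 < x := hx
  have : x ^ (2 * β + 5) = x ^ (2 * β + 4) * x := by
    rw [← rpow_add_one hx.ne']; ring_nf
  simp only [Pi.add_apply, errorWeight, this]
  ring

theorem mainTerm_integral {β : ℝ} (B T : ℝ) (hβ : -1 < β) :
    IntegrableOn (fun x => exp (-x) * mainTerm β B T x) (Set.Ioi 0) ∧
    ∫ x in Set.Ioi (0:ℝ), exp (-x) * mainTerm β B T x
      = T ^ (2 * β + 2) / (β + 1) - 2 * T ^ (2 * β + 1)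
        - B / 2 ^ (2 * β + 1) * Gamma (2 * β + 2) * (2 * β + 3) * (T - (2 * β + 3) / 2) := by
  have ha : β + 1 ≠ 0 := by linarith
  set c0 := T ^ (2 * β + 2) / (2 * (β + 1)) - T ^ (2 * β + 1) / 2 with hc0
  set c1 := (T ^ (2 * β + 2) - (β + 1) * T ^ (2 * β + 1)) / (2 * (β + 1)) with hc1
  set c2 := -T ^ (2 * β + 1) / 2 with hc2
  set d := B / 2 ^ (2 * β + 1) with hd
  have i0 := (integrableOn_exp_neg_mul_pow 0).const_mul c0
  have i1 := (integrableOn_exp_neg_mul_pow 1).const_mul c1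
  have i2 := (integrableOn_exp_neg_mul_pow 2).const_mul c2
  have j0 := (integrableOn_exp_neg_mul_rpow (p := 2 * β + 1) (by linarith)).const_mul
    (-d * (T - 1 / 2))
  have j1 := (integrableOn_exp_neg_mul_rpow (p := 2 * β + 2) (by linarith)).const_mul
    (-d * (T - 1 / 2))
  have j2 := (integrableOn_exp_neg_mul_rpow (p := 2 * β + 3) (by linarith)).const_mul (d / 2)
  have hcongr : ∀ x ∈ Set.Ioi (0:ℝ), c0 * (exp (-x) * x ^ 0) + c1 * (exp (-x) * x ^ 1)
      + c2 * (exp (-x) * x ^ 2) + -d * (T - 1 / 2) * (exp (-x) * x ^ (2 * β + 1))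
      + -d * (T - 1 / 2) * (exp (-x) * x ^ (2 * β + 2)) + d / 2 * (exp (-x) * x ^ (2 * β + 3))
      = exp (-x) * mainTerm β B T x := fun x hx => by
    have hx : 0 < x := hx
    have e2 : x ^ (2 * β + 2) = x ^ (2 * β + 1) * x := by
      rw [← rpow_add_one hx.ne']; ring_nf
    have e3 : x ^ (2 * β + 3) = x ^ (2 * β + 1) * x * x := by
      rw [← rpow_add_one hx.ne', ← rpow_add_one hx.ne']; ring_nf
    rw [mainTerm, div_rpow hx.le (by norm_num), e2, e3, hc0, hc1, hc2, hd]
    field_simp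
    ring
  have i01 := i0.add i1
  have i02 := i01.add i2
  have i03 := i02.add j0
  have i04 := i03.add j1
  have i05 := i04.add j2
  refine ⟨IntegrableOn.congr_fun i05 hcongr measurableSet_Ioi, ?_⟩
  rw [← setIntegral_congr_fun measurableSet_Ioi hcongr]
  have g1 : Gamma (2 * β + 2 + 1) = (2 * β + 2) * Gamma (2 * β + 2) :=
    Gamma_add_one (by linarith)
  have g2 : Gamma (2 * β + 3 + 1) = (2 * β + 3) * Gamma (2 * β + 2 + 1) := by
    rw [show 2 * β + 3 = 2 * β + 2 + 1 by ring]
    exact Gamma_add_one (by linarith)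
  have g0 : Gamma (2 * β + 1 + 1) = Gamma (2 * β + 2) := by ring_nf
  have k := integral_add i04 j2
  have k4 := integral_add i03 j1
  have k3 := integral_add i02 j0
  have k2 := integral_add i01 i2
  have k1 := integral_add i0 i1
  simp only [Pi.add_apply] at k k1 k2 k3 k4
  rw [k, k4, k3, k2, k1]
  simp only [MeasureTheory.integral_const_mul, setIntegral_exp_neg_mul_pow]
  rw [setIntegral_exp_neg_mul_rpow (by linarith), setIntegral_exp_neg_mul_rpow (by linarith),
    setIntegral_exp_neg_mul_rpow (by linarith), g2, g1, g0]
  simp only [hc0, hc1, hc2, Nat.factorial]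
  field_simp
  push_cast
  ring

theorem beta_mul_Gamma_eq {β : ℝ} (hβ' : β ≠ -1 / 2) :
    ProbabilityTheory.beta (1 / 2 - β) (β + 1) / 2 / 2 ^ (2 * β + 1) * Gamma (2 * β + 2)
      = (2 * β + 1) * (Gamma (1 + β) ^ 2 / (2 * cos (β * π))) := by
  have h1 := Gamma_mul_Gamma_add_half (β + 1)
  have h2 : Gamma (β + 1 + 1 / 2) = (β + 1 / 2) * Gamma (β + 1 / 2) := by
    rw [show β + 1 + 1 / 2 = β + 1 / 2 + 1 by ring]
    exact Gamma_add_one (fun h => hβ' (by linarith))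
  have h3 := Gamma_mul_Gamma_one_sub (β + 1 / 2)
  rw [show 1 - (β + 1 / 2) = 1 / 2 - β by ring,
    show π * (β + 1 / 2) = β * π + π / 2 by ring, sin_add_pi_div_two] at h3
  have h4 : Gamma (1 / 2 - β + (β + 1)) = √π / 2 := by
    rw [show 1 / 2 - β + (β + 1) = 1 / 2 + 1 by ring, Gamma_add_one (by norm_num),
      Gamma_one_half_eq]
    ring
  have h5 : (2:ℝ) ^ (1 - 2 * (β + 1)) = (2 ^ (2 * β + 1))⁻¹ := by
    rw [← rpow_neg (by norm_num)]; ring_nf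
  have hπ : √π * √π = π := mul_self_sqrt pi_pos.le
  have hs : √π ≠ 0 := (sqrt_pos.2 pi_pos).ne'
  rw [h2, h5, show 2 * (β + 1) = 2 * β + 2 by ring] at h1
  rw [ProbabilityTheory.beta, h4, add_comm 1 β]
  have h6 : Gamma (2 * β + 2) * (2 ^ (2 * β + 1))⁻¹
      = Gamma (β + 1) * ((β + 1 / 2) * Gamma (β + 1 / 2)) / √π := by
    rw [eq_div_iff hs, ← h1]
  calc _ = Gamma (1 / 2 - β) * Gamma (β + 1) / √π * (Gamma (2 * β + 2) * (2 ^ (2 * β + 1))⁻¹) := by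
        field_simp
    _ = Gamma (β + 1) ^ 2 * (β + 1 / 2) * (Gamma (β + 1 / 2) * Gamma (1 / 2 - β)) / (√π * √π) := by
        rw [h6]; field_simp
    _ = _ := by
        rw [h3, hπ]
        have := pi_pos.ne'
        field_simp

theorem setLIntegral_Ioo_ofReal {f : ℝ → ℝ} {a b : ℝ} (hab : a ≤ b)
    (hf : IntervalIntegrable f volume a b) (h0 : ∀ t ∈ Set.Ioo a b, 0 ≤ f t) :
    ∫⁻ t in Set.Ioo a b, ENNReal.ofReal (f t) = ENNReal.ofReal (∫ t in a..b, f t) := by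
  rw [integral_of_le hab, integral_Ioc_eq_integral_Ioo]
  rw [intervalIntegrable_iff_integrableOn_Ioo_of_le hab] at hf
  exact (ofReal_integral_eq_lintegral_ofReal hf
    ((ae_restrict_iff' measurableSet_Ioo).2 (Filter.Eventually.of_forall h0))).symm

theorem setLIntegral_Ioo_rpow {β t : ℝ} (hβ : -1 < β) (ht : 0 ≤ t) :
    ∫⁻ x in Set.Ioo 0 t, ENNReal.ofReal (x ^ β) = ENNReal.ofReal (t ^ (β + 1) / (β + 1)) := by
  rw [setLIntegral_Ioo_ofReal ht (intervalIntegrable_rpow' hβ) fun x hx => rpow_nonneg hx.1.le _,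
    integral_rpow (Or.inl hβ), zero_rpow (by linarith), sub_zero]

theorem setLIntegral_mul_rpow_mul_rpow_sub_lt_top {β T K : ℝ} (hβ : -1 < β) (hT : 0 ≤ T)
    {p q : ℝ → ℝ} (h : ∀ t ∈ Set.Ioo 0 T, ∀ x ∈ Set.Ioo 0 t, p x * q t ≤ K) (hK : 0 ≤ K) :
    ∫⁻ t in Set.Ioo 0 T, ∫⁻ x in Set.Ioo 0 t,
        ENNReal.ofReal (p x * (q t * (t ^ β * (t - x) ^ β))) < ⊤ := by
  have hb : ∀ t ∈ Set.Ioo 0 T, ∫⁻ x in Set.Ioo 0 t,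
        ENNReal.ofReal (p x * (q t * (t ^ β * (t - x) ^ β)))
      ≤ ENNReal.ofReal (K / (β + 1) * t ^ (2 * β + 1)) := fun t ht => by
    have ht0 : 0 ≤ t ^ β := rpow_nonneg ht.1.le _
    calc _ ≤ ∫⁻ x in Set.Ioo 0 t, ENNReal.ofReal (K * t ^ β) * ENNReal.ofReal ((t - x) ^ β) := by
          refine setLIntegral_mono' measurableSet_Ioo fun x hx => ?_
          rw [← ENNReal.ofReal_mul (by positivity)]
          refine ENNReal.ofReal_le_ofReal ?_
          have h4 : 0 ≤ (t - x) ^ β := rpow_nonneg (sub_pos.2 hx.2).le _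
          calc _ = p x * q t * (t ^ β * (t - x) ^ β) := by ring
            _ ≤ K * (t ^ β * (t - x) ^ β) := by gcongr; exact h t ht x hx
            _ = _ := by ring
      _ = _ := by
          rw [lintegral_const_mul' _ _ ENNReal.ofReal_ne_top,
            setLIntegral_Ioo_sub_left t fun x => ENNReal.ofReal (x ^ β),
            setLIntegral_Ioo_rpow hβ ht.1.le, ← ENNReal.ofReal_mul (by positivity),
            show 2 * β + 1 = β + (β + 1) by ring, rpow_add ht.1 β (β + 1)]
          congr 1
          generalize t ^ (β + 1) = z
          ring
  refine (setLIntegral_mono' measurableSet_Ioo hb).trans_lt ?_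
  have hβ1 : 0 < β + 1 := by linarith
  rw [setLIntegral_Ioo_ofReal hT ((intervalIntegrable_rpow' (by linarith)).const_mul _)
    fun t ht => mul_nonneg (by positivity) (rpow_nonneg ht.1.le _)]
  exact ENNReal.ofReal_lt_top

theorem setLIntegral_mul_rpow_mul_rpow_sub {β T K : ℝ} (hβ : -1 < β) (hT : 0 ≤ T)
    {p q : ℝ → ℝ} (hp : Measurable p) (hq : Continuous q) (hp0 : ∀ x ∈ Set.Ioi 0, 0 ≤ p x)
    (hq0 : ∀ t ∈ Set.Ioo 0 T, 0 ≤ q t) (h : ∀ t ∈ Set.Ioo 0 T, ∀ x ∈ Set.Ioo 0 t, p x * q t ≤ K)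
    (hK : 0 ≤ K) :
    IntegrableOn (fun x => p x * ∫ t in x..T, q t * (t ^ β * (t - x) ^ β)) (Set.Ioo 0 T) ∧
    ∫⁻ t in Set.Ioo 0 T, ∫⁻ x in Set.Ioo 0 t,
        ENNReal.ofReal (p x * (q t * (t ^ β * (t - x) ^ β)))
      = ENNReal.ofReal (∫ x in Set.Ioo 0 T,
        p x * ∫ t in x..T, q t * (t ^ β * (t - x) ^ β)) := by
  have hfin := setLIntegral_mul_rpow_mul_rpow_sub_lt_top hβ hT h hK
  have hmeas : Measurable fun z : ℝ × ℝ =>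
      ENNReal.ofReal (p z.1 * (q z.2 * (z.2 ^ β * (z.2 - z.1) ^ β))) := by
    have := hq.measurable
    fun_prop
  have hmeas' : Measurable fun z : ℝ × ℝ =>
      ENNReal.ofReal (p z.2 * (q z.1 * (z.1 ^ β * (z.1 - z.2) ^ β))) :=
    hmeas.comp measurable_swap
  rw [setLIntegral_Ioo_swap hmeas'] at hfin ⊢
  set m : ℝ → ENNReal := fun x => ∫⁻ t in Set.Ioo x T,
    ENNReal.ofReal (p x * (q t * (t ^ β * (t - x) ^ β))) with hm
  have hmm : Measurable m := measurable_setLIntegral_Ioo measurable_id measurable_const hmeas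
  have hval : ∀ x ∈ Set.Ioo 0 T, (m x).toReal
      = p x * ∫ t in x..T, q t * (t ^ β * (t - x) ^ β) := fun x hx => by
    have hi := ((intervalIntegrable_rpow_mul_rpow_sub hβ hx.1 hx.2.le).continuousOn_mul
      hq.continuousOn)
    have h0 : ∀ t ∈ Set.Ioo x T, 0 ≤ p x * (q t * (t ^ β * (t - x) ^ β)) := fun t ht => by
      have h1 := hp0 x hx.1
      have h2 := hq0 t ⟨hx.1.trans ht.1, ht.2⟩
      have h3 : 0 ≤ t ^ β := rpow_nonneg (hx.1.trans ht.1).le _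
      have h4 : 0 ≤ (t - x) ^ β := rpow_nonneg (sub_pos.2 ht.1).le _
      positivity
    rw [hm, ← intervalIntegral.integral_const_mul]
    simp only
    rw [setLIntegral_Ioo_ofReal hx.2.le (hi.const_mul _) h0, ENNReal.toReal_ofReal]
    rw [integral_of_le hx.2.le, integral_Ioc_eq_integral_Ioo]
    exact setIntegral_nonneg measurableSet_Ioo h0
  refine ⟨IntegrableOn.congr_fun (integrable_toReal_of_lintegral_ne_top hmm.aemeasurable hfin.ne)
    hval measurableSet_Ioo, ?_⟩
  rw [← setIntegral_congr_fun measurableSet_Ioo hval, integral_toReal hmm.aemeasurable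
    (ae_lt_top hmm hfin.ne), ENNReal.ofReal_toReal hfin.ne]

/-- The asymptotics of the terms in which `t ^ β` is convolved with a weighted exponential. -/
theorem setLIntegral_convolution_asymptotics {β : ℝ} (hβ : -1 < β) (hβ' : β < 0) :
    ∃ K : ℝ, ∀ T : ℝ, 1 ≤ T → ∃ M S : ℝ, 0 ≤ M ∧ 0 ≤ S ∧
      ∫⁻ t in Set.Ioo 0 T, ∫⁻ x in Set.Ioo 0 t,
        ENNReal.ofReal ((1 + x) * exp (-x) * ((T - t) * (t ^ β * (t - x) ^ β)))
          = ENNReal.ofReal M ∧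
      ∫⁻ t in Set.Ioo 0 T, ∫⁻ x in Set.Ioo 0 t,
        ENNReal.ofReal (exp (-x) * (1 * (t ^ β * (t - x) ^ β))) = ENNReal.ofReal S ∧
      |(2 * β + 1) * (M - S / 2) - ∫ x in Set.Ioi (0:ℝ), exp (-x) * mainTerm β
        (ProbabilityTheory.beta (1 / 2 - β) (β + 1) / 2) T x| ≤ K * T ^ (2 * β) := by
  set B := ProbabilityTheory.beta (1 / 2 - β) (β + 1) / 2 with hB
  have hB0 : 0 < B := half_pos (ProbabilityTheory.beta_pos (by linarith) (by linarith))
  refine ⟨∫ x in Set.Ioi (0:ℝ), exp (-x) * errorWeight β B x, fun T hT => ?_⟩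
  have hT0 : 0 < T := by linarith
  obtain ⟨iR, eR⟩ := setLIntegral_mul_rpow_mul_rpow_sub (T := T) (K := (1 + T) * T) hβ hT0.le
    (p := fun x => (1 + x) * exp (-x)) (q := fun t => T - t) (by fun_prop) (by fun_prop)
    (fun x hx => by have : 0 < x := hx; positivity) (fun t ht => sub_nonneg.2 ht.2.le)
    (fun t ht x hx => by
      have h1 : exp (-x) ≤ 1 := exp_le_one_iff.2 (by linarith [hx.1])
      have h2 := hx.1
      have h3 := hx.2.trans ht.2
      have h4 := ht.2
      calc (1 + x) * exp (-x) * (T - t) ≤ (1 + T) * 1 * T := by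
            gcongr
            linarith [ht.1]
        _ = _ := by ring) (by positivity)
  obtain ⟨iS, eS⟩ := setLIntegral_mul_rpow_mul_rpow_sub (T := T) (K := 1) hβ hT0.le
    (p := fun x => exp (-x)) (q := fun _ => 1) (by fun_prop) (by fun_prop)
    (fun x hx => by positivity) (fun t ht => zero_le_one)
    (fun t ht x hx => by simpa using hx.1.le) zero_le_one
  have hnn : ∀ x ∈ Set.Ioo 0 T, ∀ t ∈ Set.Ioc x T, 0 ≤ t ^ β * (t - x) ^ β := fun x hx t ht =>
    mul_nonneg (rpow_nonneg (hx.1.trans ht.1).le _) (rpow_nonneg (sub_pos.2 ht.1).le _)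
  refine ⟨_, _, ?_, ?_, eR, eS, ?_⟩
  · refine setIntegral_nonneg measurableSet_Ioo fun x hx => ?_
    have h1 := hx.1
    rw [integral_of_le hx.2.le]
    exact mul_nonneg (by positivity) (setIntegral_nonneg measurableSet_Ioc fun t ht =>
      mul_nonneg (sub_nonneg.2 ht.2) (hnn x hx t ht))
  · refine setIntegral_nonneg measurableSet_Ioo fun x hx => ?_
    rw [integral_of_le hx.2.le]
    exact mul_nonneg (by positivity) (setIntegral_nonneg measurableSet_Ioc fun t ht =>
      mul_nonneg zero_le_one (hnn x hx t ht))
  set R : ℝ → ℝ := fun x => (1 + x) * exp (-x) * ∫ t in x..T, (T - t) * (t ^ β * (t - x) ^ β)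
    with hR
  set V : ℝ → ℝ := fun x => exp (-x) * ∫ t in x..T, 1 * (t ^ β * (t - x) ^ β) with hV
  have hd : (2 * β + 1) * ((∫ x in Set.Ioo 0 T, R x) - (∫ x in Set.Ioo 0 T, V x) / 2)
      = ∫ x in Set.Ioi (0:ℝ), (Set.Ioo 0 T).indicator
        (fun x => (2 * β + 1) * (R x - V x / 2)) x := by
    rw [setIntegral_indicator measurableSet_Ioo,
      Set.inter_eq_self_of_subset_right Set.Ioo_subset_Ioi_self,
      MeasureTheory.integral_const_mul, integral_sub iR (iS.div_const 2),
      MeasureTheory.integral_div]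
  have hint : IntegrableOn ((Set.Ioo 0 T).indicator
        (fun x => (2 * β + 1) * (R x - V x / 2))) (Set.Ioi 0) := by
    refine Integrable.integrableOn ((integrable_indicator_iff measurableSet_Ioo).2 ?_)
    exact (iR.sub (iS.div_const 2)).const_mul _
  rw [hd, ← integral_sub hint (mainTerm_integral B T hβ).1, ← Real.norm_eq_abs,
    mul_comm _ (T ^ (2 * β)),
    ← MeasureTheory.integral_const_mul]
  refine norm_integral_le_of_norm_le ((integrableOn_exp_neg_mul_errorWeight B hβ).const_mul _)
    ((ae_restrict_iff' measurableSet_Ioi).2 (Filter.Eventually.of_forall fun x hx => ?_))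
  have hx : 0 < x := hx
  rw [Real.norm_eq_abs]
  rcases lt_or_ge x T with hxT | hxT
  · rw [Set.indicator_of_mem (Set.mem_Ioo.2 ⟨hx, hxT⟩)]
    obtain ⟨e, h1, h2, h3⟩ := integral_rpow_mul_rpow_sub_div_sq_tail hβ hβ' hx hxT.le hT
    rw [← hB] at h1 h3
    have h4 := abs_sub_mainTerm_le hβ hβ' hx hxT.le hT h2 h3
    have hTx : 0 < T - x / 2 := by linarith
    have hβ1 : β + 1 ≠ 0 := by linarith
    have k1 := integral_sub_mul_rpow_mul_rpow_sub hβ hx hxT.le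
    have k2 := integral_rpow_mul_rpow_sub hβ hx hxT.le
    rw [mul_assoc, h1] at k1
    rw [h1] at k2
    have k3 : (2 * β + 1) * (R x - V x / 2) = exp (-x) * (T ^ (β + 1) * (T - x) ^ (β + 1)
          * ((1 + x) / (2 * (β + 1)) - 1 / (2 * (T - x / 2)))
        - ((1 + x) * (T - x / 2) - 1 / 2) * ((x / 2) ^ (2 * β + 1) * B - e)) := by
      simp only [hR, hV, one_mul]
      calc _ = exp (-x) * ((1 + x) * ((2 * β + 1) * ∫ t in x..T, (T - t) * (t ^ β * (t - x) ^ β))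
            - ((2 * β + 1) * ∫ t in x..T, t ^ β * (t - x) ^ β) / 2) := by ring
        _ = _ := by
          rw [k1, k2]
          generalize T ^ (β + 1) * (T - x) ^ (β + 1) = N
          generalize T - x / 2 = y at hTx
          generalize (x / 2) ^ (2 * β + 1) = W
          field_simp
          ring
    rw [k3, ← mul_sub, abs_mul, abs_of_pos (exp_pos _)]
    calc _ ≤ exp (-x) * (T ^ (2 * β) * errorWeight β B x) := by gcongr
      _ = _ := by ring
  · rw [Set.indicator_of_notMem (fun h => absurd (Set.mem_Ioo.1 h).2 hxT.not_gt), zero_sub, abs_neg,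
      abs_mul, abs_of_pos (exp_pos _)]
    calc _ ≤ exp (-x) * (T ^ (2 * β) * errorWeight β B x) := by
          gcongr
          exact abs_mainTerm_le hβ hβ' hB0.le hxT hT
      _ = _ := by ring

/-- The convolution of `t ^ β` with `exp (-t)`, the solution of `g' = -g + t ^ β`, `g 0 = 0`. -/
noncomputable def expConv (β t : ℝ) : ℝ := exp (-t) * ∫ u in (0:ℝ)..t, exp u * u ^ β

theorem intervalIntegrable_exp_mul_rpow {β : ℝ} (hβ : -1 < β) (a b : ℝ) :
    IntervalIntegrable (fun u => exp u * u ^ β) volume a b :=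
  (intervalIntegrable_rpow' hβ).continuousOn_mul (by fun_prop)

theorem continuous_expConv {β : ℝ} (hβ : -1 < β) : Continuous (expConv β) := by
  unfold expConv
  exact (by fun_prop : Continuous fun t : ℝ => exp (-t)).mul
    (continuous_primitive (intervalIntegrable_exp_mul_rpow hβ) 0)

theorem expConv_nonneg {β t : ℝ} (ht : 0 ≤ t) : 0 ≤ expConv β t :=
  mul_nonneg (exp_pos _).le (integral_nonneg ht fun _ hu =>
    mul_nonneg (exp_pos _).le (rpow_nonneg hu.1 _))

theorem hasDerivAt_expConv {β t : ℝ} (hβ : -1 < β) (ht : 0 < t) :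
    HasDerivAt (expConv β) (-expConv β t + t ^ β) t := by
  have h1 : HasDerivAt (fun t => ∫ u in (0:ℝ)..t, exp u * u ^ β) (exp t * t ^ β) t := by
    refine integral_hasDerivAt_right (intervalIntegrable_exp_mul_rpow hβ 0 t) ?_ ?_
    · exact Measurable.stronglyMeasurable (by fun_prop) |>.stronglyMeasurableAtFilter
    · exact (continuous_exp.continuousAt).mul (continuousAt_rpow_const _ _ (Or.inl ht.ne'))
  have h2 : HasDerivAt (fun t => exp (-t)) (-exp (-t)) t :=
    (hasDerivAt_neg t).exp.congr_deriv (by ring)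
  refine (h2.mul h1).congr_deriv ?_
  have : exp (-t) * exp t = 1 := by rw [← exp_add]; simp
  rw [expConv]
  linear_combination t ^ β * this

theorem integral_sub_mul_expConv_sq {β T : ℝ} (hβ : -1 < β) (hT : 0 ≤ T) :
    (∫ t in (0:ℝ)..T, (T - t) * expConv β t ^ 2) + ∫ t in (0:ℝ)..T, t ^ β * expConv β t / 2
      = (∫ t in (0:ℝ)..T, (T - t) * (t ^ β * expConv β t)) + expConv β T ^ 2 / 4 := by
  have hg := continuous_expConv hβ
  have i0 : IntervalIntegrable (fun t => t ^ β * expConv β t) volume 0 T :=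
    (intervalIntegrable_rpow' hβ).mul_continuousOn hg.continuousOn
  have i1 : IntervalIntegrable (fun t => (T - t) * expConv β t ^ 2) volume 0 T :=
    Continuous.intervalIntegrable (by fun_prop) _ _
  have i2 : IntervalIntegrable (fun t => (T - t) * (t ^ β * expConv β t)) volume 0 T :=
    i0.continuousOn_mul (by fun_prop)
  have key := integral_eq_sub_of_hasDerivAt_of_le hT
    (f := fun t => -((T - t) * expConv β t ^ 2 / 2) + expConv β t ^ 2 / 4)
    (f' := fun t => (T - t) * expConv β t ^ 2 + t ^ β * expConv β t / 2
      - (T - t) * (t ^ β * expConv β t)) (by fun_prop) (fun t ht => ?_)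
    ((i1.add (i0.div_const 2)).sub i2)
  · have h0 : expConv β 0 = 0 := by simp [expConv]
    rw [integral_sub (i1.add (i0.div_const 2)) i2, integral_add i1 (i0.div_const 2)] at key
    simp only [h0] at key
    linarith
  · have h := hasDerivAt_expConv hβ ht.1
    have h2 := h.pow 2
    refine (((((hasDerivAt_id t).const_sub T).mul h2).div_const 2).neg.add
      (h2.div_const 4)).congr_deriv ?_
    simp
    ring

theorem expConv_le {β T : ℝ} (hβ : -1 < β) (hβ' : β < 0) (hT : 1 ≤ T) :
    expConv β T ≤ 2 * (1 / (β + 1) + 1) * T ^ β := by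
  have hT0 : 0 < T := by linarith
  have ha : 0 < β + 1 := by linarith
  have hT2 : 0 < T / 2 := by linarith
  have hi := intervalIntegrable_exp_mul_rpow hβ
  have h1 : ∫ u in (0:ℝ)..T / 2, exp u * u ^ β ≤ exp (T / 2) * ((T / 2) ^ (β + 1) / (β + 1)) := by
    have : ∫ u in (0:ℝ)..T / 2, exp u * u ^ β ≤ ∫ u in (0:ℝ)..T / 2, exp (T / 2) * u ^ β := by
      refine integral_mono_on hT2.le (hi _ _) ((intervalIntegrable_rpow' hβ).const_mul _)
        fun u hu => ?_
      have := rpow_nonneg hu.1 β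
      gcongr
      exact hu.2
    rwa [intervalIntegral.integral_const_mul, integral_rpow (Or.inl hβ), zero_rpow ha.ne',
      sub_zero] at this
  have h2 : ∫ u in T / 2..T, exp u * u ^ β ≤ (exp T - exp (T / 2)) * (T / 2) ^ β := by
    have : ∫ u in T / 2..T, exp u * u ^ β ≤ ∫ u in T / 2..T, exp u * (T / 2) ^ β := by
      refine integral_mono_on (by linarith) (hi _ _)
        (Continuous.intervalIntegrable (by fun_prop) _ _) fun u hu => ?_
      have := rpow_le_rpow_of_nonpos hT2 hu.1 hβ'.le
      gcongr
    rwa [intervalIntegral.integral_mul_const, integral_exp] at this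
  have h3 := integral_add_adjacent_intervals (hi 0 (T / 2)) (hi (T / 2) T)
  have h4 : (T / 2) ^ β ≤ 2 * T ^ β := div_two_rpow_le hβ.le hT0
  have h5 : exp (-T) * exp (T / 2) * (T / 2) ≤ 1 := by
    rw [← exp_add, show -T + T / 2 = -(T / 2) by ring, exp_neg, inv_mul_le_one₀ (exp_pos _)]
    linarith [add_one_le_exp (T / 2)]
  have h6 : exp (-T) * exp T = 1 := by rw [← exp_add]; simp
  have h7 : 0 < (T / 2) ^ β := by positivity
  rw [expConv, ← h3]
  calc _ ≤ exp (-T) * (exp (T / 2) * ((T / 2) ^ (β + 1) / (β + 1))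
        + (exp T - exp (T / 2)) * (T / 2) ^ β) := by gcongr
    _ = (exp (-T) * exp (T / 2) * (T / 2)) * (1 / (β + 1)) * (T / 2) ^ β
        + (exp (-T) * exp T - exp (-T) * exp (T / 2)) * (T / 2) ^ β := by
        rw [rpow_add_one hT2.ne']; ring
    _ ≤ 1 * (1 / (β + 1)) * (T / 2) ^ β + 1 * (T / 2) ^ β := by
        gcongr
        rw [h6]
        linarith [mul_pos (exp_pos (-T)) (exp_pos (T / 2))]
    _ = (1 / (β + 1) + 1) * (T / 2) ^ β := by ring
    _ ≤ (1 / (β + 1) + 1) * (2 * T ^ β) := by gcongr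
    _ = _ := by ring

theorem setLIntegral_exp_neg_mul_rpow_sub {β t : ℝ} (hβ : -1 < β) (ht : 0 ≤ t) :
    ∫⁻ x in Set.Ioo 0 t, ENNReal.ofReal (exp (-x) * (t - x) ^ β)
      = ENNReal.ofReal (expConv β t) := by
  have h := setLIntegral_Ioo_sub_left t fun u => ENNReal.ofReal (exp (u - t) * u ^ β)
  simp only [show ∀ x, t - x - t = -x by intro x; ring] at h
  rw [h, expConv, ← intervalIntegral.integral_const_mul]
  have h2 : ∀ u, exp (u - t) * u ^ β = exp (-t) * (exp u * u ^ β) := fun u => by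
    rw [← mul_assoc, ← exp_add]; ring_nf
  simp only [h2]
  exact setLIntegral_Ioo_ofReal ht ((intervalIntegrable_exp_mul_rpow hβ 0 t).const_mul _)
    fun u hu => mul_nonneg (exp_pos _).le (mul_nonneg (exp_pos _).le (rpow_nonneg hu.1.le _))

theorem lintegral_sub_mul_expConv_sq {β T : ℝ} (hβ : -1 < β) (hT : 0 ≤ T) :
    (∫⁻ t in Set.Ioo 0 T, ENNReal.ofReal (T - t)
        * (∫⁻ x in Set.Ioo 0 t, ENNReal.ofReal (exp (-x) * (t - x) ^ β)) ^ 2)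
      + (∫⁻ t in Set.Ioo 0 T, ∫⁻ x in Set.Ioo 0 t,
        ENNReal.ofReal (x * exp (-x) * ((T - t) * (t ^ β * (t - x) ^ β))))
      + (∫⁻ t in Set.Ioo 0 T, ∫⁻ x in Set.Ioo 0 t,
        ENNReal.ofReal (exp (-x) * (1 * (t ^ β * (t - x) ^ β)))) / 2
    = (∫⁻ t in Set.Ioo 0 T, ∫⁻ x in Set.Ioo 0 t,
        ENNReal.ofReal ((1 + x) * exp (-x) * ((T - t) * (t ^ β * (t - x) ^ β))))
      + ENNReal.ofReal (expConv β T ^ 2 / 4) := by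
  have hg := continuous_expConv hβ
  have i0 : IntervalIntegrable (fun t => t ^ β * expConv β t) volume 0 T :=
    (intervalIntegrable_rpow' hβ).mul_continuousOn hg.continuousOn
  have n0 : ∀ t ∈ Set.Ioo 0 T, 0 ≤ t ^ β * expConv β t := fun t ht =>
    mul_nonneg (rpow_nonneg ht.1.le _) (expConv_nonneg ht.1.le)
  have e1 : ∫⁻ t in Set.Ioo 0 T, ENNReal.ofReal (T - t)
        * (∫⁻ x in Set.Ioo 0 t, ENNReal.ofReal (exp (-x) * (t - x) ^ β)) ^ 2
      = ENNReal.ofReal (∫ t in (0:ℝ)..T, (T - t) * expConv β t ^ 2) := by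
    rw [← setLIntegral_Ioo_ofReal hT (Continuous.intervalIntegrable (by fun_prop) _ _)
      fun t ht => mul_nonneg (sub_nonneg.2 ht.2.le) (sq_nonneg _)]
    refine setLIntegral_congr_fun measurableSet_Ioo fun t ht => ?_
    rw [setLIntegral_exp_neg_mul_rpow_sub hβ ht.1.le, ← ENNReal.ofReal_pow (expConv_nonneg ht.1.le),
      ENNReal.ofReal_mul (sub_nonneg.2 ht.2.le)]
  have e2 : ∀ q : ℝ → ℝ, Continuous q → (∀ t ∈ Set.Ioo 0 T, 0 ≤ q t) →
      ∫⁻ t in Set.Ioo 0 T, ∫⁻ x in Set.Ioo 0 t,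
        ENNReal.ofReal (exp (-x) * (q t * (t ^ β * (t - x) ^ β)))
      = ENNReal.ofReal (∫ t in (0:ℝ)..T, q t * (t ^ β * expConv β t)) := fun q hq hq0 => by
    rw [← setLIntegral_Ioo_ofReal hT (i0.continuousOn_mul hq.continuousOn)
      fun t ht => mul_nonneg (hq0 t ht) (n0 t ht)]
    refine setLIntegral_congr_fun measurableSet_Ioo fun t ht => ?_
    have h1 := hq0 t ht
    have h2 : 0 ≤ q t * t ^ β := mul_nonneg h1 (rpow_nonneg ht.1.le _)
    rw [← mul_assoc, ENNReal.ofReal_mul h2, ← setLIntegral_exp_neg_mul_rpow_sub hβ ht.1.le,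
      ← lintegral_const_mul' _ _ ENNReal.ofReal_ne_top]
    refine lintegral_congr fun x => ?_
    rw [← ENNReal.ofReal_mul h2]
    congr 1
    ring
  have e3 : ∫⁻ t in Set.Ioo 0 T, ∫⁻ x in Set.Ioo 0 t,
        ENNReal.ofReal ((1 + x) * exp (-x) * ((T - t) * (t ^ β * (t - x) ^ β)))
      = (∫⁻ t in Set.Ioo 0 T, ∫⁻ x in Set.Ioo 0 t,
          ENNReal.ofReal (exp (-x) * ((T - t) * (t ^ β * (t - x) ^ β))))
        + ∫⁻ t in Set.Ioo 0 T, ∫⁻ x in Set.Ioo 0 t,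
          ENNReal.ofReal (x * exp (-x) * ((T - t) * (t ^ β * (t - x) ^ β))) := by
    have hm : Measurable fun t => ∫⁻ x in Set.Ioo 0 t,
        ENNReal.ofReal (exp (-x) * ((T - t) * (t ^ β * (t - x) ^ β))) :=
      measurable_setLIntegral_Ioo measurable_const measurable_id (by fun_prop)
    rw [← lintegral_add_left hm]
    refine setLIntegral_congr_fun measurableSet_Ioo fun t ht => ?_
    rw [← lintegral_add_left (by fun_prop)]
    refine setLIntegral_congr_fun measurableSet_Ioo fun x hx => ?_
    have h1 := hx.1
    have h2 : 0 ≤ T - t := sub_nonneg.2 ht.2.le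
    have h3 : 0 ≤ t ^ β := rpow_nonneg ht.1.le _
    have h4 : 0 ≤ (t - x) ^ β := rpow_nonneg (sub_nonneg.2 hx.2.le) _
    rw [← ENNReal.ofReal_add (by positivity) (by positivity)]
    congr 1
    ring
  rw [e1, e3, e2 (fun _ => 1) (by fun_prop) (fun _ _ => zero_le_one),
    e2 (fun t => T - t) (by fun_prop) (fun t ht => sub_nonneg.2 ht.2.le)]
  have key := integral_sub_mul_expConv_sq hβ hT
  rw [intervalIntegral.integral_div] at key
  simp only [one_mul]
  have p1 : 0 ≤ ∫ t in (0:ℝ)..T, (T - t) * expConv β t ^ 2 :=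
    integral_nonneg hT fun t ht => mul_nonneg (sub_nonneg.2 ht.2) (sq_nonneg _)
  have p2 : 0 ≤ ∫ t in (0:ℝ)..T, t ^ β * expConv β t :=
    integral_nonneg hT fun t ht => mul_nonneg (rpow_nonneg ht.1 _) (expConv_nonneg ht.1)
  have p3 : 0 ≤ ∫ t in (0:ℝ)..T, (T - t) * (t ^ β * expConv β t) :=
    integral_nonneg hT fun t ht => mul_nonneg (sub_nonneg.2 ht.2)
      (mul_nonneg (rpow_nonneg ht.1 _) (expConv_nonneg ht.1))
  have h2 : (2 : ENNReal) = ENNReal.ofReal 2 := by simp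
  rw [add_right_comm, h2, ← ENNReal.ofReal_div_of_pos (by norm_num),
    ← ENNReal.ofReal_add p1 (by positivity), key, ENNReal.ofReal_add p3 (by positivity),
    add_right_comm]

theorem setLIntegral_Ioi_linear_mul_exp {c₀ c₁ z : ℝ} (h₀ : 0 ≤ c₀) (h₁ : 0 ≤ c₁) (hz : 0 ≤ z) :
    ∫⁻ t in Set.Ioi z, ENNReal.ofReal ((c₀ + c₁ * t) * exp (z - 2 * t))
      = ENNReal.ofReal (exp (-z) * (c₀ / 2 + c₁ * (z / 2 + 1 / 4))) := by
  have hd : ∀ t ∈ Set.Ici z, HasDerivAt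
      (fun t => -((c₀ / 2 + c₁ * (t / 2 + 1 / 4)) * exp (z - 2 * t)))
      ((c₀ + c₁ * t) * exp (z - 2 * t)) t := fun t _ => by
    have e1 : HasDerivAt (fun t => exp (z - 2 * t)) (-2 * exp (z - 2 * t)) t :=
      (((hasDerivAt_id t).const_mul 2).const_sub z).exp.congr_deriv (by simp; ring)
    have e2 : HasDerivAt (fun t => c₀ / 2 + c₁ * (t / 2 + 1 / 4)) (c₁ / 2) t :=
      (((((hasDerivAt_id t).div_const 2).add_const (1 / 4)).const_mul c₁).const_add
        (c₀ / 2)).congr_deriv (by ring)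
    exact (e2.mul e1).neg.congr_deriv (by ring)
  have h0 : ∀ t ∈ Set.Ioi z, 0 ≤ (c₀ + c₁ * t) * exp (z - 2 * t) := fun t ht => by
    have : 0 ≤ t := hz.trans (le_of_lt ht)
    positivity
  have hlim : Filter.Tendsto (fun t => -((c₀ / 2 + c₁ * (t / 2 + 1 / 4)) * exp (z - 2 * t)))
      Filter.atTop (nhds 0) := by
    have h2 : Filter.Tendsto (fun t : ℝ => 2 * t) Filter.atTop Filter.atTop :=
      Filter.tendsto_id.const_mul_atTop (by norm_num)
    have l0 := (tendsto_pow_mul_exp_neg_atTop_nhds_zero 0).comp h2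
    have l1 := (tendsto_pow_mul_exp_neg_atTop_nhds_zero 1).comp h2
    have := (l0.const_mul (-exp z * (c₀ / 2 + c₁ / 4))).add (l1.const_mul (-exp z * (c₁ / 4)))
    simp only [mul_zero, add_zero] at this
    refine this.congr fun t => ?_
    simp only [Function.comp]
    rw [sub_eq_add_neg, exp_add]
    ring
  have hae := (ae_restrict_iff' measurableSet_Ioi (μ := volume)).2 (Filter.Eventually.of_forall h0)
  rw [← ofReal_integral_eq_lintegral_ofReal (integrableOn_Ioi_deriv_of_nonneg' hd h0 hlim) hae,
    integral_Ioi_of_hasDerivAt_of_nonneg' hd h0 hlim]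
  congr 1
  rw [show z - 2 * z = -z by ring]
  ring

theorem setLIntegral_Ioi_linear_mul_exp_neg_abs {c₀ c₁ s y : ℝ} (h₀ : 0 ≤ c₀) (h₁ : 0 ≤ c₁)
    (hs : 0 ≤ s) (hy : 0 ≤ y) :
    ∫⁻ t in Set.Ioi s, ENNReal.ofReal ((c₀ + c₁ * t) * exp (-t - |s + y - t|))
      = ENNReal.ofReal (exp (-(s + y)) * (c₀ * (y + 1 / 2)
        + c₁ * (s * y + y ^ 2 / 2 + (s + y) / 2 + 1 / 4))) := by
  rw [setLIntegral_Ioi_eq_Ioo_add (by linarith : s ≤ s + y)]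
  have e1 : ∫⁻ t in Set.Ioo s (s + y), ENNReal.ofReal ((c₀ + c₁ * t) * exp (-t - |s + y - t|))
      = ENNReal.ofReal (exp (-(s + y)) * (c₀ * y + c₁ * (((s + y) ^ 2 - s ^ 2) / 2))) := by
    have : ∀ t ∈ Set.Ioo s (s + y), ENNReal.ofReal ((c₀ + c₁ * t) * exp (-t - |s + y - t|))
        = ENNReal.ofReal ((c₀ + c₁ * t) * exp (-(s + y))) := fun t ht => by
      rw [abs_of_pos (sub_pos.2 ht.2)]
      ring_nf
    rw [setLIntegral_congr_fun measurableSet_Ioo this, setLIntegral_Ioo_ofReal (by linarith)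
      (Continuous.intervalIntegrable (by fun_prop) _ _)]
    · rw [intervalIntegral.integral_mul_const, intervalIntegral.integral_add (by simp)
        (Continuous.intervalIntegrable (by fun_prop) _ _), intervalIntegral.integral_const_mul,
        integral_id, intervalIntegral.integral_const, smul_eq_mul]
      congr 1
      ring
    · intro t ht
      have : 0 ≤ t := hs.trans ht.1.le
      positivity
  have e2 : ∀ t ∈ Set.Ioi (s + y), ENNReal.ofReal ((c₀ + c₁ * t) * exp (-t - |s + y - t|))
        = ENNReal.ofReal ((c₀ + c₁ * t) * exp (s + y - 2 * t)) := fun t ht => by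
    rw [abs_of_neg (sub_neg.2 ht)]
    ring_nf
  rw [e1, setLIntegral_congr_fun measurableSet_Ioi e2,
    setLIntegral_Ioi_linear_mul_exp h₀ h₁ (by linarith), ← ENNReal.ofReal_add]
  · congr 1
    ring
  · have : 0 ≤ ((s + y) ^ 2 - s ^ 2) / 2 := by nlinarith
    positivity
  · positivity

/-- The part of the density of `L2` whose contributions decay exponentially. -/
noncomputable def decayDensity (β τ : ℝ) : ENNReal :=
  (∫⁻ r in Set.Ioo 0 τ, ENNReal.ofReal (exp (-τ) * exp (-r) * (τ - r) * (τ ^ β * r ^ β)))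
    + ∫⁻ u in Set.Ioo 0 τ, ∫⁻ w in Set.Ioo 0 τ,
        ENNReal.ofReal (exp (-τ) * exp (-|u - w|) * (u ^ β * (τ - w) ^ β))

theorem measurable_decayDensity (β : ℝ) : Measurable (decayDensity β) := by
  unfold decayDensity
  refine Measurable.add (measurable_setLIntegral_Ioo measurable_const measurable_id (by fun_prop))
    (measurable_setLIntegral_Ioo measurable_const measurable_id ?_)
  exact measurable_setLIntegral_Ioo (α := ℝ × ℝ) measurable_const measurable_fst (by fun_prop)

theorem setLIntegral_square_exp_neg_abs (β τ : ℝ) :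
    ∫⁻ u in Set.Ioo 0 τ, ∫⁻ w in Set.Ioo 0 τ,
        ENNReal.ofReal (exp (-τ) * exp (-|u - w|) * (u ^ β * (τ - w) ^ β))
      = ∫⁻ s in Set.Ioo 0 τ, 2 * ∫⁻ y in Set.Ioo 0 s,
        ENNReal.ofReal (exp (-τ - |s + y - τ|) * (s ^ β * y ^ β)) := by
  have h1 : ∀ u, ∫⁻ w in Set.Ioo 0 τ,
        ENNReal.ofReal (exp (-τ) * exp (-|u - w|) * (u ^ β * (τ - w) ^ β))
      = ∫⁻ x in Set.Ioo 0 τ, ENNReal.ofReal (exp (-τ - |u + x - τ|) * (u ^ β * x ^ β)) :=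
    fun u => by
      rw [← setLIntegral_Ioo_sub_left τ fun x =>
        ENNReal.ofReal (exp (-τ - |u + x - τ|) * (u ^ β * x ^ β))]
      refine lintegral_congr fun w => ?_
      rw [← exp_add]
      ring_nf
  simp only [h1]
  rw [setLIntegral_Ioo_square (by fun_prop)]
  refine setLIntegral_congr_fun measurableSet_Ioo fun s _ => ?_
  rw [two_mul]
  congr 1
  refine lintegral_congr fun x => ?_
  ring_nf

theorem setLIntegral_Ioi_linear_mul_decayDensity {β c₀ c₁ : ℝ} (h₀ : 0 ≤ c₀) (h₁ : 0 ≤ c₁) :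
    ∫⁻ τ in Set.Ioi 0, ENNReal.ofReal (c₀ + c₁ * τ) * decayDensity β τ
      = ∫⁻ s in Set.Ioi 0, ∫⁻ y in Set.Ioo 0 s, ENNReal.ofReal (exp (-s) * s ^ β *
          (exp (-y) * y ^ β * (c₀ * (s + y + 1)
            + c₁ * (s ^ 2 + y ^ 2 + s * y + s + y + 1 / 2)))) := by
  have hm : Measurable fun p : ℝ × ℝ => ∫⁻ y in Set.Ioo 0 p.2,
      ENNReal.ofReal (exp (-p.1 - |p.2 + y - p.1|) * (p.2 ^ β * y ^ β)) :=
    measurable_setLIntegral_Ioo (α := ℝ × ℝ) measurable_const measurable_snd (by fun_prop)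
  have e2 : ∫⁻ τ in Set.Ioi 0, ENNReal.ofReal (c₀ + c₁ * τ) * ∫⁻ s in Set.Ioo 0 τ,
        2 * ∫⁻ y in Set.Ioo 0 s, ENNReal.ofReal (exp (-τ - |s + y - τ|) * (s ^ β * y ^ β))
      = ∫⁻ s in Set.Ioi 0, ∫⁻ y in Set.Ioo 0 s, ENNReal.ofReal (2 * (s ^ β * y ^ β) *
          (exp (-(s + y)) * (c₀ * (y + 1 / 2)
            + c₁ * (s * y + y ^ 2 / 2 + (s + y) / 2 + 1 / 4)))) := by
    have a1 : ∀ τ : ℝ, ENNReal.ofReal (c₀ + c₁ * τ) * ∫⁻ s in Set.Ioo 0 τ,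
        2 * ∫⁻ y in Set.Ioo 0 s, ENNReal.ofReal (exp (-τ - |s + y - τ|) * (s ^ β * y ^ β))
        = ∫⁻ s in Set.Ioo 0 τ, ENNReal.ofReal (c₀ + c₁ * τ) *
        (2 * ∫⁻ y in Set.Ioo 0 s, ENNReal.ofReal (exp (-τ - |s + y - τ|) * (s ^ β * y ^ β))) :=
      fun τ => (lintegral_const_mul' _ _ ENNReal.ofReal_ne_top).symm
    simp only [a1]
    rw [setLIntegral_Ioi_swap ((by fun_prop : Measurable fun p : ℝ × ℝ =>
      ENNReal.ofReal (c₀ + c₁ * p.1)).mul (hm.const_mul 2))]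
    refine setLIntegral_congr_fun measurableSet_Ioi fun s hs => ?_
    have hs : 0 < s := hs
    have a2 : ∀ τ : ℝ, ENNReal.ofReal (c₀ + c₁ * τ) *
        (2 * ∫⁻ y in Set.Ioo 0 s, ENNReal.ofReal (exp (-τ - |s + y - τ|) * (s ^ β * y ^ β)))
        = ∫⁻ y in Set.Ioo 0 s, ENNReal.ofReal (c₀ + c₁ * τ) *
          (2 * ENNReal.ofReal (exp (-τ - |s + y - τ|) * (s ^ β * y ^ β))) := fun τ => by
      rw [lintegral_const_mul' _ _ ENNReal.ofReal_ne_top,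
        lintegral_const_mul' _ _ ENNReal.ofNat_ne_top]
    simp only [a2]
    rw [lintegral_lintegral_swap (by fun_prop)]
    refine setLIntegral_congr_fun measurableSet_Ioo fun y hy => ?_
    have hy0 := hy.1
    rw [ENNReal.ofReal_mul (by positivity),
      ← setLIntegral_Ioi_linear_mul_exp_neg_abs h₀ h₁ hs.le hy0.le,
      ← lintegral_const_mul' _ _ ENNReal.ofReal_ne_top]
    refine setLIntegral_congr_fun measurableSet_Ioi fun τ hτ => ?_
    have hτ : 0 < τ := hs.trans hτ
    rw [← ENNReal.ofReal_mul (by positivity), show (2 : ENNReal) = ENNReal.ofReal 2 by simp,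
      ← ENNReal.ofReal_mul (by positivity), ← ENNReal.ofReal_mul (by positivity)]
    congr 1
    ring
  have e1 : ∫⁻ τ in Set.Ioi 0, ENNReal.ofReal (c₀ + c₁ * τ) * ∫⁻ r in Set.Ioo 0 τ,
        ENNReal.ofReal (exp (-τ) * exp (-r) * (τ - r) * (τ ^ β * r ^ β))
      = ∫⁻ s in Set.Ioi 0, ∫⁻ y in Set.Ioo 0 s, ENNReal.ofReal ((c₀ + c₁ * s) *
          (exp (-s) * exp (-y) * (s - y) * (s ^ β * y ^ β))) := by
    refine setLIntegral_congr_fun measurableSet_Ioi fun s hs => ?_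
    have hs : 0 < s := hs
    rw [← lintegral_const_mul' _ _ ENNReal.ofReal_ne_top]
    refine lintegral_congr fun y => ?_
    exact (ENNReal.ofReal_mul (by positivity)).symm
  have hmm : Measurable fun τ : ℝ => ENNReal.ofReal (c₀ + c₁ * τ) * ∫⁻ r in Set.Ioo 0 τ,
        ENNReal.ofReal (exp (-τ) * exp (-r) * (τ - r) * (τ ^ β * r ^ β)) :=
    (by fun_prop : Measurable fun τ : ℝ => ENNReal.ofReal (c₀ + c₁ * τ)).mul
      (measurable_setLIntegral_Ioo measurable_const measurable_id (by fun_prop))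
  have hmm' : Measurable fun s : ℝ => ∫⁻ y in Set.Ioo 0 s, ENNReal.ofReal ((c₀ + c₁ * s) *
          (exp (-s) * exp (-y) * (s - y) * (s ^ β * y ^ β))) :=
    measurable_setLIntegral_Ioo measurable_const measurable_id (by fun_prop)
  simp only [decayDensity, setLIntegral_square_exp_neg_abs, mul_add]
  rw [lintegral_add_left hmm, e1, e2, ← lintegral_add_left hmm']
  refine setLIntegral_congr_fun measurableSet_Ioi fun s hs => ?_
  have hs : 0 < s := hs
  rw [← lintegral_add_left (by fun_prop)]
  refine setLIntegral_congr_fun measurableSet_Ioo fun y hy => ?_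
  have hy0 := hy.1
  have hy1 : 0 ≤ s - y := sub_nonneg.2 hy.2.le
  rw [← ENNReal.ofReal_add (by positivity) (by positivity), neg_add, exp_add]
  congr 1
  ring

theorem setLIntegral_Ioi_exp_mul_rpow_mul_quadratic {β k₀ k₁ k₂ : ℝ} (hβ : -1 < β) (h₀ : 0 ≤ k₀)
    (h₁ : 0 ≤ k₁) (h₂ : 0 ≤ k₂) :
    ∫⁻ y in Set.Ioi 0, ENNReal.ofReal (exp (-y) * y ^ β * (k₀ + k₁ * y + k₂ * y ^ 2))
      = ENNReal.ofReal (Gamma (1 + β) * (k₀ + k₁ * (β + 1) + k₂ * ((β + 1) * (β + 2)))) := by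
  have e : ∀ y ∈ Set.Ioi (0 : ℝ), exp (-y) * y ^ β * (k₀ + k₁ * y + k₂ * y ^ 2)
      = k₀ * (exp (-y) * y ^ β) + k₁ * (exp (-y) * y ^ (β + 1))
        + k₂ * (exp (-y) * y ^ (β + 2)) := fun y hy => by
    rw [rpow_add hy, rpow_add hy, rpow_one, rpow_two]
    ring
  have i0 := (integrableOn_exp_neg_mul_rpow hβ).const_mul k₀
  have i1 := (integrableOn_exp_neg_mul_rpow (by linarith : -1 < β + 1)).const_mul k₁
  have i2 := (integrableOn_exp_neg_mul_rpow (by linarith : -1 < β + 2)).const_mul k₂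
  have i01 : IntegrableOn (fun y => k₀ * (exp (-y) * y ^ β) + k₁ * (exp (-y) * y ^ (β + 1)))
    (Set.Ioi 0) := i0.add i1
  have i012 : IntegrableOn (fun y => k₀ * (exp (-y) * y ^ β) + k₁ * (exp (-y) * y ^ (β + 1))
    + k₂ * (exp (-y) * y ^ (β + 2))) (Set.Ioi 0) := i01.add i2
  have hi : IntegrableOn (fun y => exp (-y) * y ^ β * (k₀ + k₁ * y + k₂ * y ^ 2)) (Set.Ioi 0) :=
    IntegrableOn.congr_fun i012 (fun y hy => (e y hy).symm) measurableSet_Ioi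
  rw [← ofReal_integral_eq_lintegral_ofReal hi, setIntegral_congr_fun measurableSet_Ioi e,
    MeasureTheory.integral_add i01 i2, MeasureTheory.integral_add i0 i1,
    MeasureTheory.integral_const_mul, MeasureTheory.integral_const_mul,
    MeasureTheory.integral_const_mul, setIntegral_exp_neg_mul_rpow hβ,
    setIntegral_exp_neg_mul_rpow (by linarith), setIntegral_exp_neg_mul_rpow (by linarith)]
  · congr 1
    rw [show β + 2 + 1 = β + 1 + 1 + 1 by ring, Gamma_add_one (by linarith : β + 1 + 1 ≠ 0),
      Gamma_add_one (by linarith : β + 1 ≠ 0), add_comm 1 β]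
    ring
  · rw [Filter.EventuallyLE, ae_restrict_iff' measurableSet_Ioi]
    refine Filter.Eventually.of_forall fun y hy => ?_
    have : (0 : ℝ) < y := hy
    simp only [Pi.zero_apply]
    positivity

theorem setLIntegral_Ioi_linear_mul_decayDensity_eq_Gamma {β c₀ c₁ : ℝ} (hβ : -1 < β)
    (h₀ : 0 ≤ c₀) (h₁ : 0 ≤ c₁) :
    ∫⁻ τ in Set.Ioi 0, ENNReal.ofReal (c₀ + c₁ * τ) * decayDensity β τ
      = ENNReal.ofReal (1 / 2 * Gamma (1 + β) ^ 2 * (c₀ * (2 * β + 3)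
        + c₁ * (3 * (β + 1) ^ 2 + 4 * (β + 1) + 1 / 2))) := by
  set k : ℝ → ℝ → ENNReal := fun s y => ENNReal.ofReal (exp (-s) * s ^ β *
          (exp (-y) * y ^ β * (c₀ * (s + y + 1)
            + c₁ * (s ^ 2 + y ^ 2 + s * y + s + y + 1 / 2)))) with hk
  have hsym : ∀ s y, k s y = k y s := fun s y => by
    simp only [hk]
    ring_nf
  have hΓ : 0 < Gamma (1 + β) := Gamma_pos_of_pos (by linarith)
  have hm : Measurable fun p : ℝ × ℝ => k p.1 p.2 := by
    simp only [hk]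
    fun_prop
  have hm1 : Measurable fun s : ℝ => ∫⁻ y in Set.Ioo 0 s, k s y :=
    measurable_setLIntegral_Ioo measurable_const measurable_id hm
  have h2 : ∫⁻ s in Set.Ioi 0, ∫⁻ y in Set.Ioi 0, k s y
      = 2 * ∫⁻ s in Set.Ioi 0, ∫⁻ y in Set.Ioo 0 s, k s y := by
    rw [setLIntegral_Ioi_square hm, ← lintegral_const_mul _ hm1]
    refine lintegral_congr fun s => ?_
    rw [two_mul]
    simp only [hsym]
  have h3 : ∫⁻ s in Set.Ioi 0, ∫⁻ y in Set.Ioi 0, k s y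
      = ENNReal.ofReal (Gamma (1 + β) * (Gamma (1 + β) * (c₀ * (2 * β + 3)
        + c₁ * (3 * (β + 1) ^ 2 + 4 * (β + 1) + 1 / 2)))) := by
    have : ∀ s ∈ Set.Ioi (0 : ℝ), ∫⁻ y in Set.Ioi 0, k s y = ENNReal.ofReal (Gamma (1 + β)) *
        ENNReal.ofReal (exp (-s) * s ^ β * ((c₀ + c₁ / 2 + (c₀ + c₁) * (β + 1)
          + c₁ * ((β + 1) * (β + 2))) + (c₀ + c₁ + c₁ * (β + 1)) * s + c₁ * s ^ 2)) :=
      fun s hs => by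
        have hs : 0 < s := hs
        have e : ∀ y, k s y = ENNReal.ofReal (exp (-s) * s ^ β) * ENNReal.ofReal
            (exp (-y) * y ^ β * ((c₀ * (s + 1) + c₁ * (s ^ 2 + s + 1 / 2))
              + (c₀ + c₁ * (s + 1)) * y + c₁ * y ^ 2)) := fun y => by
          rw [← ENNReal.ofReal_mul (by positivity)]
          simp only [hk]
          ring_nf
        simp only [e]
        rw [lintegral_const_mul' _ _ ENNReal.ofReal_ne_top,
          setLIntegral_Ioi_exp_mul_rpow_mul_quadratic hβ (by positivity) (by positivity) h₁,
          ← ENNReal.ofReal_mul (by positivity), ← ENNReal.ofReal_mul hΓ.le]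
        congr 1
        ring
    have hb : 0 < β + 1 := by linarith
    have hb2 : 0 < β + 2 := by linarith
    rw [setLIntegral_congr_fun measurableSet_Ioi this,
      lintegral_const_mul' _ _ ENNReal.ofReal_ne_top,
      setLIntegral_Ioi_exp_mul_rpow_mul_quadratic hβ (by positivity) (by positivity) h₁,
      ← ENNReal.ofReal_mul hΓ.le]
    congr 1
    ring
  rw [setLIntegral_Ioi_linear_mul_decayDensity h₀ h₁]
  refine (ENNReal.mul_right_inj two_ne_zero ENNReal.ofNat_ne_top).1 (h2.symm.trans (h3.trans ?_))
  rw [show (2 : ENNReal) = ENNReal.ofReal 2 by simp, ← ENNReal.ofReal_mul (by norm_num)]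
  congr 1
  ring

theorem decayDensity_le {β τ : ℝ} (hβ : -1 < β) (hτ : 0 < τ) :
    decayDensity β τ ≤ ENNReal.ofReal (1 / (β + 1) + (1 / (β + 1)) ^ 2)
      * ENNReal.ofReal (exp (-τ) * τ ^ (2 * β + 2)) := by
  have hb : 0 < β + 1 := by linarith
  have hp : τ ^ (2 * β + 2) = τ ^ (β + 1) * τ ^ (β + 1) := by
    rw [← rpow_add hτ]
    ring_nf
  have h1 : ∫⁻ r in Set.Ioo 0 τ, ENNReal.ofReal (exp (-τ) * exp (-r) * (τ - r) * (τ ^ β * r ^ β))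
      ≤ ENNReal.ofReal (1 / (β + 1) * (exp (-τ) * τ ^ (2 * β + 2))) := by
    calc _ ≤ ∫⁻ r in Set.Ioo 0 τ, ENNReal.ofReal (exp (-τ) * τ ^ (β + 1))
            * ENNReal.ofReal (r ^ β) := by
          refine setLIntegral_mono' measurableSet_Ioo fun r hr => ?_
          have hr0 := hr.1
          rw [← ENNReal.ofReal_mul (by positivity), rpow_add_one hτ.ne']
          refine ENNReal.ofReal_le_ofReal ?_
          calc exp (-τ) * exp (-r) * (τ - r) * (τ ^ β * r ^ β)
              ≤ exp (-τ) * 1 * τ * (τ ^ β * r ^ β) := by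
                have : 0 ≤ τ - r := sub_nonneg.2 hr.2.le
                gcongr
                · exact exp_le_one_iff.2 (by linarith)
                · linarith
            _ = _ := by ring
      _ = _ := by
          rw [lintegral_const_mul' _ _ ENNReal.ofReal_ne_top, setLIntegral_Ioo_rpow hβ hτ.le,
            ← ENNReal.ofReal_mul (by positivity), hp]
          congr 1
          ring
  have h2 : ∫⁻ u in Set.Ioo 0 τ, ∫⁻ w in Set.Ioo 0 τ,
        ENNReal.ofReal (exp (-τ) * exp (-|u - w|) * (u ^ β * (τ - w) ^ β))
      ≤ ENNReal.ofReal ((1 / (β + 1)) ^ 2 * (exp (-τ) * τ ^ (2 * β + 2))) := by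
    calc _ ≤ ∫⁻ u in Set.Ioo 0 τ, ∫⁻ w in Set.Ioo 0 τ, ENNReal.ofReal (exp (-τ) * u ^ β)
            * ENNReal.ofReal ((τ - w) ^ β) := by
          refine setLIntegral_mono' measurableSet_Ioo fun u hu =>
            setLIntegral_mono' measurableSet_Ioo fun w hw => ?_
          have hu0 := hu.1
          have hw0 : 0 ≤ τ - w := sub_nonneg.2 hw.2.le
          rw [← ENNReal.ofReal_mul (by positivity)]
          refine ENNReal.ofReal_le_ofReal ?_
          calc exp (-τ) * exp (-|u - w|) * (u ^ β * (τ - w) ^ β)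
              ≤ exp (-τ) * 1 * (u ^ β * (τ - w) ^ β) := by
                gcongr
                exact exp_le_one_iff.2 (neg_nonpos.2 (abs_nonneg _))
            _ = _ := by ring
      _ = ∫⁻ u in Set.Ioo 0 τ, ENNReal.ofReal (exp (-τ) * (τ ^ (β + 1) / (β + 1)))
            * ENNReal.ofReal (u ^ β) := by
          refine setLIntegral_congr_fun measurableSet_Ioo fun u hu => ?_
          have hu0 := hu.1
          rw [lintegral_const_mul' _ _ ENNReal.ofReal_ne_top,
            setLIntegral_Ioo_sub_left τ fun w => ENNReal.ofReal (w ^ β),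
            setLIntegral_Ioo_rpow hβ hτ.le, ← ENNReal.ofReal_mul (by positivity),
            ← ENNReal.ofReal_mul (by positivity)]
          congr 1
          ring
      _ = _ := by
          rw [lintegral_const_mul' _ _ ENNReal.ofReal_ne_top, setLIntegral_Ioo_rpow hβ hτ.le,
            ← ENNReal.ofReal_mul (by positivity), hp]
          congr 1
          ring
  refine (add_le_add h1 h2).trans ?_
  rw [← ENNReal.ofReal_add (by positivity) (by positivity), ← ENNReal.ofReal_mul (by positivity),
    add_mul]

theorem setLIntegral_cube_mul_decayDensity_ne_top {β : ℝ} (hβ : -1 < β) :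
    ∫⁻ τ in Set.Ioi 0, ENNReal.ofReal (τ ^ 3) * decayDensity β τ ≠ ⊤ := by
  have hi := integrableOn_exp_neg_mul_rpow (by linarith : -1 < 2 * β + 5)
  have hle : ∫⁻ τ in Set.Ioi 0, ENNReal.ofReal (τ ^ 3) * decayDensity β τ
      ≤ ∫⁻ τ in Set.Ioi 0, ENNReal.ofReal (1 / (β + 1) + (1 / (β + 1)) ^ 2)
        * ENNReal.ofReal (exp (-τ) * τ ^ (2 * β + 5)) := by
    refine setLIntegral_mono' measurableSet_Ioi fun τ hτ => ?_
    have hτ : 0 < τ := hτ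
    refine (mul_le_mul_right (decayDensity_le hβ hτ) _).trans (le_of_eq ?_)
    rw [mul_left_comm, ← ENNReal.ofReal_mul (by positivity)]
    congr 2
    rw [show 2 * β + 5 = 2 * β + 2 + (3 : ℕ) by push_cast; ring, rpow_add_natCast hτ.ne']
    ring
  refine ne_top_of_le_ne_top ?_ hle
  rw [lintegral_const_mul' _ _ ENNReal.ofReal_ne_top]
  exact ENNReal.mul_ne_top ENNReal.ofReal_ne_top hi.lintegral_lt_top.ne

theorem setLIntegral_sub_mul_decayDensity_asymptotics {β : ℝ} (hβ : -1 < β) :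
    ∃ K, ∀ T, 1 ≤ T → ∃ X, 0 ≤ X ∧
      ∫⁻ τ in Set.Ioo 0 T, ENNReal.ofReal (T - τ) * decayDensity β τ = ENNReal.ofReal X ∧
      |X - 1 / 2 * Gamma (1 + β) ^ 2
        * ((2 * β + 3) * T - (3 * (β + 1) ^ 2 + 4 * (β + 1) + 1 / 2))| ≤ K * T ^ (2 * β) := by
  set Y := ∫⁻ τ in Set.Ioi 0, ENNReal.ofReal (τ ^ 3) * decayDensity β τ with hY
  have hYt := setLIntegral_cube_mul_decayDensity_ne_top hβ
  refine ⟨Y.toReal, fun T hT => ?_⟩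
  have hT0 : 0 < T := by linarith
  have hb : 0 < β + 1 := by linarith
  have hb3 : 0 < 2 * β + 3 := by linarith
  have hm := measurable_decayDensity β
  have hc := setLIntegral_Ioi_linear_mul_decayDensity_eq_Gamma (c₀ := T) (c₁ := 0) hβ hT0.le le_rfl
  have hl := setLIntegral_Ioi_linear_mul_decayDensity_eq_Gamma (c₀ := 0) (c₁ := 1) hβ le_rfl
    zero_le_one
  simp only [zero_mul, add_zero, zero_add, one_mul] at hc hl
  have hs : (∫⁻ τ in Set.Ioi 0, ENNReal.ofReal (T - τ) * decayDensity β τ)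
      + (∫⁻ τ in Set.Ioi 0, ENNReal.ofReal τ * decayDensity β τ)
      = (∫⁻ τ in Set.Ioi 0, ENNReal.ofReal T * decayDensity β τ)
        + ∫⁻ τ in Set.Ioi 0, ENNReal.ofReal (τ - T) * decayDensity β τ := by
    rw [← lintegral_add_left (by fun_prop), ← lintegral_add_left (by fun_prop)]
    refine setLIntegral_congr_fun measurableSet_Ioi fun τ hτ => ?_
    have hτ : 0 < τ := hτ
    rw [← add_mul, ← add_mul]
    congr 1
    rcases le_total τ T with h | h
    · rw [ENNReal.ofReal_of_nonpos (by linarith : τ - T ≤ 0), add_zero,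
        ← ENNReal.ofReal_add (by linarith) hτ.le, sub_add_cancel]
    · rw [ENNReal.ofReal_of_nonpos (by linarith : T - τ ≤ 0), zero_add,
        ← ENNReal.ofReal_add hT0.le (by linarith), add_sub_cancel]
  have hZ : ∫⁻ τ in Set.Ioi 0, ENNReal.ofReal (τ - T) * decayDensity β τ
      ≤ ENNReal.ofReal (T ^ (2 * β)) * Y := by
    rw [hY, ← lintegral_const_mul' _ _ ENNReal.ofReal_ne_top]
    refine setLIntegral_mono' measurableSet_Ioi fun τ hτ => ?_
    have hτ : 0 < τ := hτ
    rw [← mul_assoc, ← ENNReal.ofReal_mul (by positivity)]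
    refine mul_le_mul_left (ENNReal.ofReal_le_ofReal ?_) _
    rcases le_total τ T with h | h
    · exact (by linarith : τ - T ≤ 0).trans (by positivity)
    · have h1 : T ^ (-2 : ℝ) ≤ T ^ (2 * β) := rpow_le_rpow_of_exponent_le hT (by linarith)
      have h2 : T ^ (-2 : ℝ) * T ^ 2 = 1 := by
        rw [← rpow_two, ← rpow_add hT0]
        simp
      calc τ - T ≤ T ^ (-2 : ℝ) * T ^ 2 * τ := by rw [h2]; linarith
        _ ≤ T ^ (2 * β) * τ ^ 2 * τ := by gcongr
        _ = _ := by ring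
  have hZt := ne_top_of_le_ne_top (ENNReal.mul_ne_top ENNReal.ofReal_ne_top hYt) hZ
  have hX : ∫⁻ τ in Set.Ioi 0, ENNReal.ofReal (T - τ) * decayDensity β τ
      = ∫⁻ τ in Set.Ioo 0 T, ENNReal.ofReal (T - τ) * decayDensity β τ := by
    rw [setLIntegral_Ioi_eq_Ioo_add hT0.le, setLIntegral_congr_fun (g := fun _ => 0)
      measurableSet_Ioi fun τ hτ => ?_, lintegral_zero, add_zero]
    rw [ENNReal.ofReal_of_nonpos (sub_nonpos.2 (le_of_lt hτ)), zero_mul]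
  rw [hc, hl, hX] at hs
  have hXt : ∫⁻ τ in Set.Ioo 0 T, ENNReal.ofReal (T - τ) * decayDensity β τ ≠ ⊤ := by
    refine ne_top_of_le_ne_top ?_ (le_self_add.trans hs.le)
    exact ENNReal.add_ne_top.2 ⟨ENNReal.ofReal_ne_top, hZt⟩
  refine ⟨_, ENNReal.toReal_nonneg, (ENNReal.ofReal_toReal hXt).symm, ?_⟩
  have hs' := congrArg ENNReal.toReal hs
  rw [ENNReal.toReal_add hXt ENNReal.ofReal_ne_top, ENNReal.toReal_add ENNReal.ofReal_ne_top hZt,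
    ENNReal.toReal_ofReal (by positivity), ENNReal.toReal_ofReal (by positivity)] at hs'
  have hZ' := ENNReal.toReal_mono (ENNReal.mul_ne_top ENNReal.ofReal_ne_top hYt) hZ
  rw [ENNReal.toReal_mul, ENNReal.toReal_ofReal (by positivity)] at hZ'
  have hZ0 := ENNReal.toReal_nonneg
    (a := ∫⁻ τ in Set.Ioi 0, ENNReal.ofReal (τ - T) * decayDensity β τ)
  rw [abs_le]
  constructor <;> nlinarith

theorem intervalIntegral_eq_toReal_setLIntegral {a b : ℝ} (hab : a ≤ b) {f : ℝ → ℝ}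
    {g : ℝ → ENNReal} (hg : Measurable g) (hfin : ∀ x ∈ Set.Ioo a b, g x ≠ ⊤)
    (h : ∀ x ∈ Set.Ioo a b, f x = (g x).toReal) :
    ∫ x in a..b, f x = (∫⁻ x in Set.Ioo a b, g x).toReal := by
  rw [intervalIntegral.integral_of_le hab, integral_Ioc_eq_integral_Ioo,
    setIntegral_congr_fun measurableSet_Ioo h]
  refine integral_toReal hg.aemeasurable ?_
  rw [ae_restrict_iff' measurableSet_Ioo]
  exact Filter.Eventually.of_forall fun x hx => (hfin x hx).lt_top

theorem setLIntegral_Ioo_abs_sub_rpow_le {β s t : ℝ} (hβ : -1 < β) (hs : s ∈ Set.Ioo 0 t) :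
    ∫⁻ x in Set.Ioo 0 t, ENNReal.ofReal (|s - x| ^ β)
      ≤ ENNReal.ofReal (2 * t ^ (β + 1) / (β + 1)) := by
  have hb : 0 < β + 1 := by linarith
  have h0 := hs.1
  have h1 : 0 < t - s := sub_pos.2 hs.2
  have ht : 0 < t := by linarith
  have e1 : ∫⁻ x in Set.Ioo 0 s, ENNReal.ofReal (|s - x| ^ β)
      = ENNReal.ofReal (s ^ (β + 1) / (β + 1)) := by
    rw [setLIntegral_Ioo_sub_left s fun x => ENNReal.ofReal (|x| ^ β),
      ← setLIntegral_Ioo_rpow hβ h0.le]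
    refine setLIntegral_congr_fun measurableSet_Ioo fun x hx => ?_
    rw [abs_of_pos hx.1]
  have e2 : ∫⁻ x in Set.Ioo s t, ENNReal.ofReal (|s - x| ^ β)
      = ENNReal.ofReal ((t - s) ^ (β + 1) / (β + 1)) := by
    simp only [abs_sub_comm s]
    rw [setLIntegral_Ioo_sub_right s t s fun x => ENNReal.ofReal (|x| ^ β), sub_self,
      ← setLIntegral_Ioo_rpow hβ h1.le]
    refine setLIntegral_congr_fun measurableSet_Ioo fun x hx => ?_
    rw [abs_of_pos hx.1]
  rw [setLIntegral_Ioo_add h0.le hs.2.le, e1, e2, ← ENNReal.ofReal_add (by positivity)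
    (by positivity)]
  refine ENNReal.ofReal_le_ofReal ?_
  calc s ^ (β + 1) / (β + 1) + (t - s) ^ (β + 1) / (β + 1)
      ≤ t ^ (β + 1) / (β + 1) + t ^ (β + 1) / (β + 1) := by
        gcongr
        · exact hs.2.le
        · linarith
    _ = _ := by ring

theorem exp_neg_mul_integral_eq_toReal {β t : ℝ} (hβ : -1 < β) (ht : 0 < t) :
    ENNReal.ofReal (exp (-t)) * (∫⁻ t₂ in Set.Ioo 0 t, ∫⁻ s₁ in Set.Ioo 0 t, ∫⁻ s₂ in Set.Ioo 0 t,
        ENNReal.ofReal (exp (s₁ - |t₂ - s₂|) * (t - t₂) ^ β * |s₁ - s₂| ^ β)) ≠ ⊤ ∧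
    exp (-t) * ∫ t₂ in (0 : ℝ)..t, ∫ s₁ in (0 : ℝ)..t, ∫ s₂ in (0 : ℝ)..t,
        exp (s₁ - |t₂ - s₂|) * (t - t₂) ^ β * |s₁ - s₂| ^ β
      = (ENNReal.ofReal (exp (-t)) * ∫⁻ t₂ in Set.Ioo 0 t, ∫⁻ s₁ in Set.Ioo 0 t,
        ∫⁻ s₂ in Set.Ioo 0 t,
        ENNReal.ofReal (exp (s₁ - |t₂ - s₂|) * (t - t₂) ^ β * |s₁ - s₂| ^ β)).toReal := by
  have hb : 0 < β + 1 := by linarith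
  set C : ENNReal := ENNReal.ofReal (2 * t ^ (β + 1) / (β + 1))
  have b1 : ∀ t₂ ∈ Set.Ioo 0 t, ∀ s₁ ∈ Set.Ioo 0 t, ∫⁻ s₂ in Set.Ioo 0 t,
      ENNReal.ofReal (exp (s₁ - |t₂ - s₂|) * (t - t₂) ^ β * |s₁ - s₂| ^ β)
      ≤ ENNReal.ofReal (exp t * (t - t₂) ^ β) * C := fun t₂ h₂ s₁ h₁ => by
    have ht₂ : 0 ≤ t - t₂ := sub_nonneg.2 h₂.2.le
    calc _ ≤ ∫⁻ s₂ in Set.Ioo 0 t, ENNReal.ofReal (exp t * (t - t₂) ^ β)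
          * ENNReal.ofReal (|s₁ - s₂| ^ β) := by
          refine lintegral_mono fun s₂ => ?_
          rw [← ENNReal.ofReal_mul (by positivity)]
          refine ENNReal.ofReal_le_ofReal ?_
          gcongr
          linarith [abs_nonneg (t₂ - s₂), h₁.2]
      _ ≤ _ := by
          rw [lintegral_const_mul' _ _ ENNReal.ofReal_ne_top]
          gcongr
          exact setLIntegral_Ioo_abs_sub_rpow_le hβ h₁
  have b2 : ∀ t₂ ∈ Set.Ioo 0 t, ∫⁻ s₁ in Set.Ioo 0 t, ∫⁻ s₂ in Set.Ioo 0 t,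
      ENNReal.ofReal (exp (s₁ - |t₂ - s₂|) * (t - t₂) ^ β * |s₁ - s₂| ^ β)
      ≤ ENNReal.ofReal (exp t) * C * ENNReal.ofReal t * ENNReal.ofReal ((t - t₂) ^ β) :=
    fun t₂ h₂ => by
      refine (setLIntegral_mono' measurableSet_Ioo (b1 t₂ h₂)).trans (le_of_eq ?_)
      rw [setLIntegral_const, Real.volume_Ioo, sub_zero, ENNReal.ofReal_mul (exp_pos t).le]
      ring
  have b3 : ∫⁻ t₂ in Set.Ioo 0 t, ∫⁻ s₁ in Set.Ioo 0 t, ∫⁻ s₂ in Set.Ioo 0 t,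
      ENNReal.ofReal (exp (s₁ - |t₂ - s₂|) * (t - t₂) ^ β * |s₁ - s₂| ^ β)
      ≤ ENNReal.ofReal (exp t) * C * ENNReal.ofReal t * ENNReal.ofReal (t ^ (β + 1) / (β + 1)) := by
    refine (setLIntegral_mono' measurableSet_Ioo b2).trans (le_of_eq ?_)
    rw [lintegral_const_mul _ (by fun_prop),
      setLIntegral_Ioo_sub_left t fun x => ENNReal.ofReal (x ^ β), setLIntegral_Ioo_rpow hβ ht.le]
  have hCt : ENNReal.ofReal (exp t) * C * ENNReal.ofReal t ≠ ⊤ :=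
    ENNReal.mul_ne_top (ENNReal.mul_ne_top ENNReal.ofReal_ne_top ENNReal.ofReal_ne_top)
      ENNReal.ofReal_ne_top
  refine ⟨ENNReal.mul_ne_top ENNReal.ofReal_ne_top
    (ne_top_of_le_ne_top (ENNReal.mul_ne_top hCt ENNReal.ofReal_ne_top) b3), ?_⟩
  rw [ENNReal.toReal_mul, ENNReal.toReal_ofReal (exp_pos _).le]
  congr 1
  refine intervalIntegral_eq_toReal_setLIntegral ht.le ?_ (fun t₂ h₂ => ne_top_of_le_ne_top
    (ENNReal.mul_ne_top hCt ENNReal.ofReal_ne_top) (b2 t₂ h₂)) fun t₂ h₂ => ?_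
  · exact measurable_setLIntegral_Ioo measurable_const measurable_const
      (measurable_setLIntegral_Ioo (α := ℝ × ℝ) measurable_const measurable_const (by fun_prop))
  refine intervalIntegral_eq_toReal_setLIntegral ht.le ?_ (fun s₁ h₁ => ne_top_of_le_ne_top
    (ENNReal.mul_ne_top ENNReal.ofReal_ne_top ENNReal.ofReal_ne_top) (b1 t₂ h₂ s₁ h₁))
    fun s₁ h₁ => ?_
  · exact measurable_setLIntegral_Ioo measurable_const measurable_const (by fun_prop)
  have ht₂ : 0 ≤ t - t₂ := sub_nonneg.2 h₂.2.le
  refine intervalIntegral_eq_toReal_setLIntegral ht.le (by fun_prop)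
    (fun _ _ => ENNReal.ofReal_ne_top) fun s₂ _ => ?_
  rw [ENNReal.toReal_ofReal (by positivity)]

theorem exp_neg_mul_setLIntegral_reflect {β t : ℝ} :
    ENNReal.ofReal (exp (-t)) * ∫⁻ t₂ in Set.Ioo 0 t, ∫⁻ s₁ in Set.Ioo 0 t, ∫⁻ s₂ in Set.Ioo 0 t,
        ENNReal.ofReal (exp (s₁ - |t₂ - s₂|) * (t - t₂) ^ β * |s₁ - s₂| ^ β)
      = ∫⁻ u in Set.Ioo 0 t, ∫⁻ v in Set.Ioo 0 t, ∫⁻ w in Set.Ioo 0 t,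
        ENNReal.ofReal (exp (-v) * exp (-|u - w|) * u ^ β * |v - w| ^ β) := by
  rw [← lintegral_const_mul' _ _ ENNReal.ofReal_ne_top, ← setLIntegral_Ioo_sub_left t fun u =>
    ∫⁻ v in Set.Ioo 0 t, ∫⁻ w in Set.Ioo 0 t,
        ENNReal.ofReal (exp (-v) * exp (-|u - w|) * u ^ β * |v - w| ^ β)]
  refine lintegral_congr fun u => ?_
  rw [← lintegral_const_mul' _ _ ENNReal.ofReal_ne_top, ← setLIntegral_Ioo_sub_left t fun v =>
    ∫⁻ w in Set.Ioo 0 t, ENNReal.ofReal (exp (-v) * exp (-|t - u - w|) * (t - u) ^ β * |v - w| ^ β)]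
  refine lintegral_congr fun v => ?_
  rw [← lintegral_const_mul' _ _ ENNReal.ofReal_ne_top, ← setLIntegral_Ioo_sub_left t fun w =>
    ENNReal.ofReal (exp (-(t - v)) * exp (-|t - u - w|) * (t - u) ^ β * |t - v - w| ^ β)]
  refine lintegral_congr fun w => ?_
  rw [← ENNReal.ofReal_mul (exp_pos _).le, show t - u - (t - w) = w - u by ring,
    show t - v - (t - w) = w - v by ring, abs_sub_comm w u, abs_sub_comm w v,
    sub_eq_add_neg v |u - w|, exp_add, show -(t - v) = -t + v by ring, exp_add]
  ring_nf

theorem L2_eq_toReal {β T : ℝ} (hβ : -1 < β) (hT : 0 ≤ T) :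
    L2 β T = (∫⁻ t in Set.Ioo 0 T, ∫⁻ u in Set.Ioo 0 t, ∫⁻ v in Set.Ioo 0 t, ∫⁻ w in Set.Ioo 0 t,
        ENNReal.ofReal (exp (-v) * exp (-|u - w|) * u ^ β * |v - w| ^ β)).toReal := by
  refine intervalIntegral_eq_toReal_setLIntegral hT ?_ (fun t ht => ?_) fun t ht => ?_
  · exact measurable_setLIntegral_Ioo measurable_const measurable_id
      (measurable_setLIntegral_Ioo (α := ℝ × ℝ) measurable_const measurable_fst
        (measurable_setLIntegral_Ioo (α := (ℝ × ℝ) × ℝ) measurable_const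
          (measurable_fst.comp measurable_fst) (by fun_prop)))
  · rw [← exp_neg_mul_setLIntegral_reflect]
    exact (exp_neg_mul_integral_eq_toReal hβ ht.1).1
  · rw [← exp_neg_mul_setLIntegral_reflect]
    exact (exp_neg_mul_integral_eq_toReal hβ ht.1).2

theorem setLIntegral_square_exp_mul_abs_rpow (β τ : ℝ) :
    ∫⁻ v in Set.Ioo 0 τ, ∫⁻ w in Set.Ioo 0 τ,
        ENNReal.ofReal (exp (-v) * exp (-|τ - w|) * τ ^ β * |v - w| ^ β)
      = (∫⁻ x in Set.Ioo 0 τ, ENNReal.ofReal (x * exp (-x) * (τ ^ β * (τ - x) ^ β)))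
        + ∫⁻ r in Set.Ioo 0 τ,
          ENNReal.ofReal (exp (-τ) * exp (-r) * (τ - r) * (τ ^ β * r ^ β)) := by
  set q : ℝ → ENNReal := fun r => ENNReal.ofReal (exp (-τ) * exp r * τ ^ β * |r| ^ β) with hq
  have hqm : Measurable q := by
    simp only [hq]
    fun_prop
  have e : ∫⁻ v in Set.Ioo 0 τ, ∫⁻ w in Set.Ioo 0 τ,
        ENNReal.ofReal (exp (-v) * exp (-|τ - w|) * τ ^ β * |v - w| ^ β)
      = ∫⁻ v in Set.Ioo 0 τ, ∫⁻ w in Set.Ioo 0 τ, q (w - v) := by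
    refine lintegral_congr fun v => setLIntegral_congr_fun measurableSet_Ioo fun w hw => ?_
    simp only [hq]
    rw [abs_of_pos (sub_pos.2 hw.2), abs_sub_comm v, ← exp_add, ← exp_add]
    ring_nf
  rw [e, setLIntegral_Ioo_difference τ hqm,
    ← setLIntegral_Ioo_sub_left τ fun x => ENNReal.ofReal (x * exp (-x) * (τ ^ β * (τ - x) ^ β)),
    ← lintegral_add_left (by fun_prop)]
  refine setLIntegral_congr_fun measurableSet_Ioo fun r hr => ?_
  have hr0 := hr.1
  have hτ : 0 < τ := hr0.trans hr.2
  have hr1 : 0 < τ - r := sub_pos.2 hr.2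
  simp only [hq]
  rw [mul_add, ← ENNReal.ofReal_mul hr1.le, ← ENNReal.ofReal_mul hr1.le, abs_neg, abs_of_pos hr0,
    show -(τ - r) = -τ + r by ring, exp_add]
  congr 2
  · ring_nf
  · ring_nf

theorem setLIntegral_cube_kernel (β t : ℝ) :
    ∫⁻ u in Set.Ioo 0 t, ∫⁻ v in Set.Ioo 0 t, ∫⁻ w in Set.Ioo 0 t,
        ENNReal.ofReal (exp (-v) * exp (-|u - w|) * u ^ β * |v - w| ^ β)
      = ∫⁻ τ in Set.Ioo 0 t, ((∫⁻ x in Set.Ioo 0 τ, ENNReal.ofReal (exp (-x) * (τ - x) ^ β)) ^ 2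
        + (∫⁻ x in Set.Ioo 0 τ, ENNReal.ofReal (x * exp (-x) * (τ ^ β * (τ - x) ^ β)))
        + decayDensity β τ) := by
  rw [setLIntegral_Ioo_cube (by fun_prop)]
  refine setLIntegral_congr_fun measurableSet_Ioo fun τ hτ => ?_
  have h2 : ∫⁻ u in Set.Ioo 0 τ, ∫⁻ w in Set.Ioo 0 τ,
        ENNReal.ofReal (exp (-τ) * exp (-|u - w|) * u ^ β * |τ - w| ^ β)
      = ∫⁻ u in Set.Ioo 0 τ, ∫⁻ w in Set.Ioo 0 τ,
        ENNReal.ofReal (exp (-τ) * exp (-|u - w|) * (u ^ β * (τ - w) ^ β)) := by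
    refine lintegral_congr fun u => setLIntegral_congr_fun measurableSet_Ioo fun w hw => ?_
    rw [abs_of_pos (sub_pos.2 hw.2), mul_assoc]
  have h3 : ∫⁻ u in Set.Ioo 0 τ, ∫⁻ v in Set.Ioo 0 τ,
        ENNReal.ofReal (exp (-v) * exp (-|u - τ|) * u ^ β * |v - τ| ^ β)
      = (∫⁻ x in Set.Ioo 0 τ, ENNReal.ofReal (exp (-x) * (τ - x) ^ β)) ^ 2 := by
    rw [sq, ← setLIntegral_Ioo_sub_left τ, ← lintegral_mul_const _ (by fun_prop)]
    refine setLIntegral_congr_fun measurableSet_Ioo fun u hu => ?_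
    rw [← lintegral_const_mul _ (by fun_prop)]
    refine setLIntegral_congr_fun measurableSet_Ioo fun v hv => ?_
    have hu0 := hu.1
    have hu1 : 0 < τ - u := sub_pos.2 hu.2
    rw [sub_sub_cancel_left, abs_neg, abs_of_pos hu0, abs_sub_comm v, abs_of_pos (sub_pos.2 hv.2),
      ← ENNReal.ofReal_mul (by positivity)]
    ring_nf
  rw [setLIntegral_square_exp_mul_abs_rpow, h2, h3, decayDensity]
  ring

theorem setLIntegral_Ioo_setLIntegral_Ioo (T : ℝ) {f : ℝ → ENNReal} (hf : Measurable f) :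
    ∫⁻ t in Set.Ioo 0 T, ∫⁻ s in Set.Ioo 0 t, f s
      = ∫⁻ s in Set.Ioo 0 T, ENNReal.ofReal (T - s) * f s := by
  rw [setLIntegral_Ioo_swap (f := fun _ s => f s) (by fun_prop)]
  refine lintegral_congr fun s => ?_
  rw [setLIntegral_const, Real.volume_Ioo, mul_comm]

theorem L2_eq_toReal_add {β T : ℝ} (hβ : -1 < β) (hT : 0 ≤ T) :
    L2 β T = ((∫⁻ t in Set.Ioo 0 T, ENNReal.ofReal (T - t)
          * (∫⁻ x in Set.Ioo 0 t, ENNReal.ofReal (exp (-x) * (t - x) ^ β)) ^ 2)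
        + (∫⁻ t in Set.Ioo 0 T, ∫⁻ x in Set.Ioo 0 t,
            ENNReal.ofReal (x * exp (-x) * ((T - t) * (t ^ β * (t - x) ^ β))))
        + ∫⁻ t in Set.Ioo 0 T, ENNReal.ofReal (T - t) * decayDensity β t).toReal := by
  have m1 : Measurable fun t : ℝ =>
      (∫⁻ x in Set.Ioo 0 t, ENNReal.ofReal (exp (-x) * (t - x) ^ β)) ^ 2 :=
    (measurable_setLIntegral_Ioo measurable_const measurable_id (by fun_prop)).pow_const 2
  have m2 : Measurable fun t : ℝ => ∫⁻ x in Set.Ioo 0 t,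
      ENNReal.ofReal (x * exp (-x) * (t ^ β * (t - x) ^ β)) :=
    measurable_setLIntegral_Ioo measurable_const measurable_id (by fun_prop)
  have m3 := measurable_decayDensity β
  rw [L2_eq_toReal hβ hT]
  simp only [setLIntegral_cube_kernel]
  rw [setLIntegral_Ioo_setLIntegral_Ioo T (by fun_prop)]
  simp only [mul_add]
  rw [lintegral_add_left (by fun_prop), lintegral_add_left (by fun_prop)]
  congr 3
  refine setLIntegral_congr_fun measurableSet_Ioo fun t ht => ?_
  have hTt : 0 ≤ T - t := sub_nonneg.2 ht.2.le
  rw [← lintegral_const_mul' _ _ ENNReal.ofReal_ne_top]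
  refine lintegral_congr fun x => ?_
  rw [← ENNReal.ofReal_mul hTt]
  ring_nf

theorem stmt_17 (H β : ℝ)
    (hH : H ∈ Set.Ioo (1/2 : ℝ) (3/4) ∪ Set.Ioo (3/4 : ℝ) 1) (hβ : β = 2 * H - 2) :
    ∃ M c : ℝ, ∀ T > c,
      |L2 β T -
        ((1/2) * (Real.Gamma (1 + β)) ^ 2 *
            ((2 * β + 3) * (1 - 1 / Real.cos (β * π)) * (T - (2 * β + 3) / 2)
              - (β + 1) * (β + 3))
          + T ^ (2 * β + 2) / ((β + 1) * (2 * β + 1))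
          - (2 / (2 * β + 1)) * T ^ (2 * β + 1))|
        ≤ M * T ^ (2 * β) := by
  obtain ⟨hβ1, hβ0, hβ2⟩ : -1 < β ∧ β < 0 ∧ β ≠ -1 / 2 := by
    rcases hH with h | h
    · exact ⟨by linarith [h.1], by linarith [h.2], fun e => by linarith [h.2]⟩
    · exact ⟨by linarith [h.1], by linarith [h.2], fun e => by linarith [h.1]⟩
  obtain ⟨K₁, h₁⟩ := setLIntegral_convolution_asymptotics hβ1 hβ0
  obtain ⟨K₂, h₂⟩ := setLIntegral_sub_mul_decayDensity_asymptotics hβ1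
  refine ⟨K₁ / |2 * β + 1| + K₂ + (1 / (β + 1) + 1) ^ 2, 1, fun T hT => ?_⟩
  have hT0 : 0 < T := by linarith
  have hd : 2 * β + 1 ≠ 0 := fun e => hβ2 (by linarith)
  obtain ⟨M, S, hM, hS, eM, eS, hMS⟩ := h₁ T hT.le
  obtain ⟨X, hX, eX, hXb⟩ := h₂ T hT.le
  have hE := lintegral_sub_mul_expConv_sq hβ1 hT0.le
  have hL := L2_eq_toReal_add hβ1 hT0.le
  rw [eX] at hL
  rw [eM, eS] at hE
  set E := (∫⁻ t in Set.Ioo 0 T, ENNReal.ofReal (T - t)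
          * (∫⁻ x in Set.Ioo 0 t, ENNReal.ofReal (exp (-x) * (t - x) ^ β)) ^ 2)
        + ∫⁻ t in Set.Ioo 0 T, ∫⁻ x in Set.Ioo 0 t,
            ENNReal.ofReal (x * exp (-x) * ((T - t) * (t ^ β * (t - x) ^ β)))
  have hEt : E ≠ ⊤ := ne_top_of_le_ne_top
    (ENNReal.add_ne_top.2 ⟨ENNReal.ofReal_ne_top, ENNReal.ofReal_ne_top⟩)
    (le_self_add.trans hE.le)
  have hE' := congrArg ENNReal.toReal hE
  rw [ENNReal.toReal_add hEt (ENNReal.div_ne_top ENNReal.ofReal_ne_top two_ne_zero),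
    ENNReal.toReal_add ENNReal.ofReal_ne_top ENNReal.ofReal_ne_top, ENNReal.toReal_div,
    ENNReal.toReal_ofReal hM, ENNReal.toReal_ofReal hS, ENNReal.toReal_ofReal (by positivity),
    ENNReal.toReal_ofNat] at hE'
  rw [ENNReal.toReal_add hEt ENNReal.ofReal_ne_top, ENNReal.toReal_ofReal hX] at hL
  rw [(mainTerm_integral _ T hβ1).2, beta_mul_Gamma_eq hβ2] at hMS
  have hsq : T ^ (2 * β) = T ^ β * T ^ β := by
    rw [← rpow_add hT0]
    ring_nf
  have hq : expConv β T ^ 2 / 4 ≤ (1 / (β + 1) + 1) ^ 2 * T ^ (2 * β) := by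
    have := pow_le_pow_left₀ (expConv_nonneg hT0.le) (expConv_le hβ1 hβ0 hT.le) 2
    rw [hsq]
    linarith
  set I := T ^ (2 * β + 2) / (β + 1) - 2 * T ^ (2 * β + 1)
    - (2 * β + 1) * (Gamma (1 + β) ^ 2 / (2 * cos (β * π))) * (2 * β + 3) * (T - (2 * β + 3) / 2)
    with hI
  have hMS' : |M - S / 2 - I / (2 * β + 1)| ≤ K₁ / |2 * β + 1| * T ^ (2 * β) := by
    rw [show M - S / 2 - I / (2 * β + 1) = ((2 * β + 1) * (M - S / 2) - I) / (2 * β + 1) by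
      field_simp, abs_div, div_mul_eq_mul_div]
    gcongr
  have key : L2 β T -
        ((1/2) * (Real.Gamma (1 + β)) ^ 2 *
            ((2 * β + 3) * (1 - 1 / Real.cos (β * π)) * (T - (2 * β + 3) / 2)
              - (β + 1) * (β + 3))
          + T ^ (2 * β + 2) / ((β + 1) * (2 * β + 1))
          - (2 / (2 * β + 1)) * T ^ (2 * β + 1))
      = (M - S / 2 - I / (2 * β + 1)) + (X - 1 / 2 * Gamma (1 + β) ^ 2
        * ((2 * β + 3) * T - (3 * (β + 1) ^ 2 + 4 * (β + 1) + 1 / 2))) + expConv β T ^ 2 / 4 := by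
    have hb : β + 1 ≠ 0 := by linarith
    have hI' : I / (2 * β + 1) = T ^ (2 * β + 2) / ((β + 1) * (2 * β + 1))
        - (2 / (2 * β + 1)) * T ^ (2 * β + 1)
        - Gamma (1 + β) ^ 2 / 2 * (1 / cos (β * π)) * (2 * β + 3) * (T - (2 * β + 3) / 2) := by
      rw [hI, show Gamma (1 + β) ^ 2 / (2 * cos (β * π))
        = Gamma (1 + β) ^ 2 / 2 * (1 / cos (β * π)) by ring]
      rw [← div_div]
      linear_combination -(Gamma (1 + β) ^ 2 / 2 * (1 / cos (β * π)) * (2 * β + 3)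
        * (T - (2 * β + 3) / 2)) * mul_inv_cancel₀ hd
    rw [hI', hL]
    linear_combination hE'
  rw [key]
  refine (abs_add_three _ _ _).trans ?_
  rw [abs_of_nonneg (by positivity : 0 ≤ expConv β T ^ 2 / 4)]
  linarith
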